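/- arXiv:2312.06124 — 3 statements merged into one kernel-verified Lean document; each statement's English description precedes it below -/
import Mathlib

section
/- Let R be a Noetherian local ring and let M, N be nonzero finitely generated R-modules. If Ext^i_R(M,N) = 0 for all 1 ≤ i ≤ depth_R(N), then Hom_R(M,N) ≠ 0 and depth_R(Hom_R(M,N)) = depth_R(N). -/
open CategoryTheory Opposite

universe u

noncomputable section

/-- The Ext module `Ext^i_R(M,N)`. -/
def ExtMod (R : Type u) [CommRing R] (M N : ModuleCat.{u} R) (i : ℕ) : ModuleCat.{u} R :=
  ((Ext R (ModuleCat.{u} R) i).obj (op M)).obj N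

/-- The Tor module `Tor_i^R(M,N)`. -/
def TorMod (R : Type u) [CommRing R] (M N : ModuleCat.{u} R) (i : ℕ) : ModuleCat.{u} R :=
  ((Tor (ModuleCat.{u} R) i).obj M).obj N

/-- The depth of a module over a local ring, as the least `i` with
`Ext^i(k, M) ≠ 0`. -/
def moduleDepth (R : Type u) [CommRing R] [IsLocalRing R] (M : ModuleCat.{u} R) : ℕ∞ :=
  sInf {i : ℕ∞ | ∃ n : ℕ, i = n ∧
    Nontrivial (ExtMod R (ModuleCat.of R (IsLocalRing.ResidueField R)) M n)}

/-- A Cohen-Macaulay local ring of dimension `d`. -/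
def IsCMLocalOfDim (R : Type u) [CommRing R] [IsLocalRing R] [IsNoetherianRing R] (d : ℕ) : Prop :=
  ringKrullDim R = d ∧ moduleDepth R (ModuleCat.of R R) = d

/-- Totally reflexive modules. -/
def TotallyReflexive (R : Type u) [CommRing R] (M : Type u) [AddCommGroup M] [Module R M] : Prop :=
  Function.Bijective (Module.Dual.eval R M) ∧
  ∀ i : ℕ, 1 ≤ i →
    Subsingleton (ExtMod R (ModuleCat.of R M) (ModuleCat.of R R) i) ∧
    Subsingleton (ExtMod R (ModuleCat.of R (Module.Dual R M)) (ModuleCat.of R R) i)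

/-- `GdimLE R n M` : the Gorenstein dimension of `M` is at most `n`. -/
def GdimLE (R : Type u) [CommRing R] : ℕ → ModuleCat.{u} R → Prop
  | 0, M => TotallyReflexive R M
  | (n+1), M => ∃ (G : ModuleCat.{u} R) (g : G →ₗ[R] M), Module.Finite R G ∧
      TotallyReflexive R G ∧ Function.Surjective g ∧
      GdimLE R n (ModuleCat.of R (LinearMap.ker g))

/-- Finite Gorenstein dimension. -/
def FiniteGdim (R : Type u) [CommRing R] (M : Type u) [AddCommGroup M] [Module R M] : Prop :=
  ∃ n, GdimLE R n (ModuleCat.of R M)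

/-- `PdLE R n M` : the projective dimension of `M` is at most `n`. -/
def PdLE (R : Type u) [CommRing R] : ℕ → ModuleCat.{u} R → Prop
  | 0, M => Module.Projective R M
  | (n+1), M => ∃ (G : ModuleCat.{u} R) (g : G →ₗ[R] M), Module.Projective R G ∧
      Function.Surjective g ∧ PdLE R n (ModuleCat.of R (LinearMap.ker g))

/-- Finite projective dimension. -/
def FinitePd (R : Type u) [CommRing R] (M : Type u) [AddCommGroup M] [Module R M] : Prop :=
  ∃ n, PdLE R n (ModuleCat.of R M)

/-- A semidualizing module. -/
def Semidualizing (R : Type u) [CommRing R] (C : Type u) [AddCommGroup C] [Module R C] : Prop :=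
  Module.Finite R C ∧
  Function.Bijective (LinearMap.toSpanSingleton R (C →ₗ[R] C) LinearMap.id) ∧
  ∀ i : ℕ, 1 ≤ i → Subsingleton (ExtMod R (ModuleCat.of R C) (ModuleCat.of R C) i)

/-- Membership in the Auslander class with respect to `C`. -/
def InAuslanderClass (R : Type u) [CommRing R] (C : Type u) [AddCommGroup C] [Module R C]
    (X : Type u) [AddCommGroup X] [Module R X] : Prop :=
  Function.Bijective ((TensorProduct.mk R C X).flip) ∧
  (∀ i : ℕ, 1 ≤ i → Subsingleton (TorMod R (ModuleCat.of R C) (ModuleCat.of R X) i)) ∧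
  (∀ i : ℕ, 1 ≤ i →
    Subsingleton (ExtMod R (ModuleCat.of R C) (ModuleCat.of R (TensorProduct R C X)) i))

/-- Height of a prime ideal. -/
def primeHt (R : Type u) [CommRing R] (p : Ideal R) (hp : p.IsPrime) : ℕ∞ :=
  Order.height (⟨p, hp⟩ : PrimeSpectrum R)

/-- Finite injective dimension, via vanishing of `Ext` in high degrees. -/
def FiniteInjDim (R : Type u) [CommRing R] (M : Type u) [AddCommGroup M] [Module R M] : Prop :=
  ∃ n : ℕ, ∀ (N : ModuleCat.{u} R) (i : ℕ), n < i →
    Subsingleton (ExtMod R N (ModuleCat.of R M) i)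

/-- A canonical (dualizing) module over a Cohen-Macaulay local ring:
a semidualizing module of finite injective dimension. -/
def IsCanonicalModule (R : Type u) [CommRing R] (w : Type u) [AddCommGroup w] [Module R w] : Prop :=
  Semidualizing R w ∧ FiniteInjDim R w

end
section Aux

/-- The bridge between the two definitions of `Ext`. -/
lemma extMod_subsingleton_iff (R : Type u) [CommRing R] (M N : ModuleCat.{u} R) (n : ℕ) :
    Subsingleton (ExtMod R M N n) ↔ Subsingleton (Abelian.Ext.{u} M N n) := by
  let P : ProjectiveResolution M := projectiveResolution M
  have h1 : Subsingleton (ExtMod R M N n) ↔ (P.complex.linearYonedaObj R N).ExactAt n := by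
    rw [HomologicalComplex.exactAt_iff_isZero_homology]
    refine ⟨fun h => ?_, fun h => ?_⟩
    · refine Limits.IsZero.of_iso ?_ (P.isoExt (R := R) n N).symm
      have : Subsingleton (((Ext R (ModuleCat.{u} R) n).obj (op M)).obj N) := h
      exact ModuleCat.isZero_of_subsingleton _
    · have := h.of_iso (P.isoExt (R := R) n N)
      exact ModuleCat.subsingleton_of_isZero this
  rw [h1]
  cases n with
  | zero =>
    rw [HomologicalComplex.exactAt_iff' _ 0 0 1 (by simp) (by simp),
      ShortComplex.moduleCat_exact_iff, Abelian.Ext.addEquiv₀.subsingleton_congr]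
    refine ⟨fun h => ?_, fun h x hx => ?_⟩
    · refine subsingleton_of_forall_eq 0 fun f => ?_
      obtain ⟨y, hy⟩ := h (P.π.f 0 ≫ f) (by
        change P.complex.d 1 0 ≫ P.π.f 0 ≫ f = 0
        exact ((Category.assoc _ _ _).symm.trans
          (congrArg (· ≫ f) P.complex_d_comp_π_f_zero)).trans Limits.zero_comp)
      have hz : ∀ z : P.complex.X 0 ⟶ N, P.complex.d 0 0 ≫ z = 0 := fun z => by
        rw [P.complex.shape 0 0 (by simp), Limits.zero_comp]
      have hy' : 0 = P.π.f 0 ≫ f := (hz y).symm.trans hy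
      have : P.π.f 0 ≫ f = P.π.f 0 ≫ 0 := by rw [← hy', Limits.comp_zero]
      exact (cancel_epi (P.π.f 0)).mp this
    · have hx' : P.complex.d 1 0 ≫ (x : P.complex.X 0 ⟶ N) = 0 := hx
      refine ⟨0, ?_⟩
      rw [map_zero]
      obtain ⟨l, hl⟩ := Limits.CokernelCofork.IsColimit.desc' P.isColimitCokernelCofork _ hx'
      have hl0 : l = 0 := @Subsingleton.elim (M ⟶ N) h l 0
      rw [hl0, Limits.comp_zero] at hl
      exact hl
  | succ n =>
    rw [HomologicalComplex.exactAt_iff' _ n (n+1) (n+2) (by simp) (by simp),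
      ShortComplex.moduleCat_exact_iff]
    refine ⟨fun h => ?_, fun h x hx => ?_⟩
    · refine subsingleton_of_forall_eq 0 fun e => ?_
      obtain ⟨f, hf, rfl⟩ := P.extMk_surjective e (n + 2) rfl
      rw [P.extMk_eq_zero_iff f (n+2) rfl hf n rfl]
      exact h f hf
    · exact (P.extMk_eq_zero_iff x (n+2) rfl hx n rfl).mp (Subsingleton.elim _ _)

lemma ext_sub3 {R : Type u} [CommRing R] (X : ModuleCat.{u} R) {S : ShortComplex (ModuleCat.{u} R)}
    (hS : S.ShortExact) (n : ℕ) (h2 : Subsingleton (Abelian.Ext.{u} X S.X₂ n))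
    (h1 : Subsingleton (Abelian.Ext.{u} X S.X₁ (n + 1))) :
    Subsingleton (Abelian.Ext.{u} X S.X₃ n) := by
  refine subsingleton_of_forall_eq 0 fun e => ?_
  obtain ⟨y, rfl⟩ := Abelian.Ext.covariant_sequence_exact₃ X hS e rfl (Subsingleton.elim _ _)
  rw [Subsingleton.elim y 0, Abelian.Ext.zero_comp]

lemma ext_sub1 {R : Type u} [CommRing R] (X : ModuleCat.{u} R) {S : ShortComplex (ModuleCat.{u} R)}
    (hS : S.ShortExact) (n : ℕ)
    (h0 : ∀ e : Abelian.Ext.{u} X S.X₁ (n + 1), e.comp (Abelian.Ext.mk₀ S.f) (add_zero _) = 0)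
    (h3 : Subsingleton (Abelian.Ext.{u} X S.X₃ n)) :
    Subsingleton (Abelian.Ext.{u} X S.X₁ (n + 1)) := by
  refine subsingleton_of_forall_eq 0 fun e => ?_
  obtain ⟨y, rfl⟩ := Abelian.Ext.covariant_sequence_exact₁ X hS e (h0 e) rfl
  rw [Subsingleton.elim y 0, Abelian.Ext.zero_comp]

/-- The short complex given by multiplication by `r` on `A`, followed by `g`. -/
abbrev smulSC {R : Type u} [CommRing R] {A B : Type u} [AddCommGroup A] [Module R A]
    [AddCommGroup B] [Module R B] (r : R) (g : A →ₗ[R] B) (w : ∀ a, g (r • a) = 0) :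
    ShortComplex (ModuleCat.{u} R) :=
  ShortComplex.mk (X₁ := ModuleCat.of R A) (X₂ := ModuleCat.of R A) (X₃ := ModuleCat.of R B)
    (r • 𝟙 (ModuleCat.of R A)) (ModuleCat.ofHom g) (by ext a; exact w a)

lemma smulSC_shortExact {R : Type u} [CommRing R] {A B : Type u} [AddCommGroup A] [Module R A]
    [AddCommGroup B] [Module R B] (r : R) (g : A →ₗ[R] B) (w : ∀ a, g (r • a) = 0)
    (hr : IsSMulRegular A r) (hg : Function.Surjective g) (hk : ∀ a, g a = 0 → ∃ b, r • b = a) :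
    (smulSC r g w).ShortExact where
  exact := by
    rw [ShortComplex.moduleCat_exact_iff]
    exact hk
  mono_f := by
    rw [ModuleCat.mono_iff_injective]
    exact hr
  epi_g := by
    rw [ModuleCat.epi_iff_surjective]
    exact hg

lemma smulSC_ext_iff {R : Type u} [CommRing R] {A B : Type u} [AddCommGroup A] [Module R A]
    [AddCommGroup B] [Module R B] (r : R) (g : A →ₗ[R] B) (w : ∀ a, g (r • a) = 0)
    (hS : (smulSC r g w).ShortExact) (K : ModuleCat.{u} R) (hK : r ∈ Module.annihilator R K)
    (n : ℕ) (h : Subsingleton (Abelian.Ext.{u} K (ModuleCat.of R A) n)) :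
    Subsingleton (Abelian.Ext.{u} K (ModuleCat.of R B) n) ↔
      Subsingleton (Abelian.Ext.{u} K (ModuleCat.of R A) (n + 1)) := by
  refine ⟨fun h3 => ext_sub1 K hS n (fun e => ?_) h3, fun h1 => ext_sub3 K hS n h h1⟩
  have := Abelian.Ext.postcomp_smul_id_eq_zero_of_mem_annihilator (M := ModuleCat.of R A) hK (n + 1)
  exact congrArg (fun f => f.hom e) this

lemma lift_of_ext_one {R : Type u} [CommRing R] {A B : Type u} [AddCommGroup A] [Module R A]
    [AddCommGroup B] [Module R B] (r : R) (g : A →ₗ[R] B) (w : ∀ a, g (r • a) = 0)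
    (hS : (smulSC r g w).ShortExact) (M : Type u) [AddCommGroup M] [Module R M]
    (hM1 : Subsingleton (Abelian.Ext.{u} (ModuleCat.of R M) (ModuleCat.of R A) 1))
    (f : M →ₗ[R] B) : ∃ y : M →ₗ[R] A, ∀ m, g (y m) = f m := by
  obtain ⟨y, hy⟩ := Abelian.Ext.covariant_sequence_exact₃ (ModuleCat.of R M) hS
    (Abelian.Ext.mk₀ (ModuleCat.ofHom f)) (zero_add 1) (Subsingleton.elim _ _)
  obtain ⟨y, rfl⟩ := Abelian.Ext.addEquiv₀.symm.surjective y
  rw [Abelian.Ext.addEquiv₀_symm_apply, Abelian.Ext.mk₀_comp_mk₀] at hy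
  have h2 := Abelian.Ext.addEquiv₀.symm.injective hy
  exact ⟨y.hom, fun m => LinearMap.congr_fun (congrArg ModuleCat.Hom.hom h2) m⟩

lemma ext_zero_iff {R : Type u} [CommRing R] (A B : Type u) [AddCommGroup A] [Module R A]
    [AddCommGroup B] [Module R B] :
    Subsingleton (Abelian.Ext.{u} (ModuleCat.of R A) (ModuleCat.of R B) 0) ↔
      Subsingleton (A →ₗ[R] B) :=
  (Abelian.Ext.addEquiv₀.trans ModuleCat.homAddEquiv).subsingleton_congr

lemma exists_surj_residue (R : Type u) [CommRing R] [IsLocalRing R]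
    (M : Type u) [AddCommGroup M] [Module R M] [Module.Finite R M] [Nontrivial M] :
    ∃ g : M →ₗ[R] IsLocalRing.ResidueField R, Function.Surjective g := by
  obtain ⟨K, hK⟩ := IsCoatomic.exists_coatom (Submodule R M)
  have : IsSimpleModule R (M ⧸ K) := isSimpleModule_iff_isCoatom.mpr hK
  obtain ⟨I, hI, ⟨e⟩⟩ := isSimpleModule_iff_quot_maximal.mp this
  obtain rfl := IsLocalRing.eq_maximalIdeal hI
  exact ⟨e.toLinearMap ∘ₗ K.mkQ, e.surjective.comp K.mkQ_surjective⟩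

theorem main_aux (R : Type u) [CommRing R] [IsLocalRing R] [IsNoetherianRing R]
    (M : Type u) [AddCommGroup M] [Module R M] [Module.Finite R M] [Nontrivial M] (t : ℕ) :
    ∀ (N : Type u) [AddCommGroup N] [Module R N] [Module.Finite R N] [Nontrivial N],
    (∀ i < t, Subsingleton (Abelian.Ext.{u} (ModuleCat.of R (IsLocalRing.ResidueField R))
      (ModuleCat.of R N) i)) →
    ¬ Subsingleton (Abelian.Ext.{u} (ModuleCat.of R (IsLocalRing.ResidueField R))
      (ModuleCat.of R N) t) →
    (∀ i, 1 ≤ i → i ≤ t → Subsingleton (Abelian.Ext.{u} (ModuleCat.of R M)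
      (ModuleCat.of R N) i)) →
    Nontrivial (M →ₗ[R] N) ∧
    (∀ i < t, Subsingleton (Abelian.Ext.{u} (ModuleCat.of R (IsLocalRing.ResidueField R))
      (ModuleCat.of R (M →ₗ[R] N)) i)) ∧
    ¬ Subsingleton (Abelian.Ext.{u} (ModuleCat.of R (IsLocalRing.ResidueField R))
      (ModuleCat.of R (M →ₗ[R] N)) t) := by
  induction t with
  | zero =>
    intro N _ _ _ _ _ h0 _
    rw [ext_zero_iff, not_subsingleton_iff_nontrivial] at h0
    obtain ⟨f, hf⟩ := exists_ne (0 : IsLocalRing.ResidueField R →ₗ[R] N)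
    obtain ⟨g, hg⟩ := exists_surj_residue R M
    have hfg : f ∘ₗ g ≠ 0 := fun h => hf <| by
      ext x
      obtain ⟨y, rfl⟩ := hg x
      exact LinearMap.congr_fun h y
    have hn : Nontrivial (M →ₗ[R] N) := ⟨⟨_, _, hfg⟩⟩
    refine ⟨hn, by simp, ?_⟩
    rw [ext_zero_iff, not_subsingleton_iff_nontrivial]
    let F : IsLocalRing.ResidueField R →ₗ[R] (M →ₗ[R] N) :=
      LinearMap.mk₂ R (fun a m => f (a * g m)) (by intros; simp [add_mul])
        (by intros; simp) (by intros; simp [mul_add]) (by intros; simp)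
    refine ⟨⟨F, 0, fun h => hfg ?_⟩⟩
    ext m
    have := LinearMap.congr_fun (LinearMap.congr_fun h 1) m
    simpa [F] using this
  | succ t ih =>
    intro N _ _ _ _ hlt hne hv
    have h0 := hlt 0 (by omega)
    rw [ext_zero_iff] at h0
    have : Module.Finite R (IsLocalRing.ResidueField R) := inferInstance
    obtain ⟨x, hx, hreg⟩ := IsSMulRegular.subsingleton_linearMap_iff.mp h0
    have hxm : x ∈ IsLocalRing.maximalIdeal R := by
      have := Module.mem_annihilator.mp hx 1
      rw [Algebra.smul_def, mul_one] at this
      exact (IsLocalRing.residue_eq_zero_iff x).mp this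
    let q : N →ₗ[R] QuotSMulTop x N := Submodule.mkQ _
    have hq : Function.Surjective q := Submodule.mkQ_surjective _
    have w : ∀ a, q (x • a) = 0 := fun a =>
      (Submodule.Quotient.mk_eq_zero _).mpr (Submodule.smul_mem_pointwise_smul _ _ _ trivial)
    have hk : ∀ a, q a = 0 → ∃ b, x • b = a := fun a ha => by
      have := (Submodule.Quotient.mk_eq_zero _).mp ha
      obtain ⟨b, -, hb⟩ := (Submodule.mem_smul_pointwise_iff_exists _ _ _).mp this
      exact ⟨b, hb⟩
    have hS := smulSC_shortExact x q w hreg hq hk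
    have hnt : Nontrivial (QuotSMulTop x N) := by
      refine Submodule.Quotient.nontrivial_iff.mpr fun h => ?_
      have hlt : IsLocalRing.maximalIdeal R • (⊤ : Submodule R N) ≠ ⊤ :=
        (Submodule.top_ne_ideal_smul_of_le_jacobson_annihilator
          (IsLocalRing.maximalIdeal_le_jacobson _)).symm
      have hle : Ideal.span {x} • (⊤ : Submodule R N) ≤
          IsLocalRing.maximalIdeal R • (⊤ : Submodule R N) :=
        Submodule.smul_mono_left ((Ideal.span_singleton_le_iff_mem _).mpr hxm)
      rw [Submodule.ideal_span_singleton_smul, h] at hle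
      exact hlt (top_le_iff.mp hle)
    have hExt := smulSC_ext_iff x q w hS (ModuleCat.of R (IsLocalRing.ResidueField R)) hx
    have hM1 : Subsingleton (Abelian.Ext.{u} (ModuleCat.of R M) (ModuleCat.of R N) 1) :=
      hv 1 le_rfl (by omega)
    obtain ⟨i1, i2, i3⟩ := ih (QuotSMulTop x N)
      (fun i hi => (hExt i (hlt i (by omega))).mpr (hlt (i+1) (by omega)))
      (fun h => hne ((hExt t (hlt t (by omega))).mp h))
      (fun i h1 hi => ext_sub3 _ hS i (hv i h1 (by omega)) (hv (i+1) (by omega) (by omega)))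
    let Q : (M →ₗ[R] N) →ₗ[R] (M →ₗ[R] QuotSMulTop x N) := LinearMap.llcomp R _ _ _ q
    have Qw : ∀ a, Q (x • a) = 0 := fun a => by
      ext m
      exact w (a m)
    have Qreg : IsSMulRegular (M →ₗ[R] N) x := fun a b hab => by
      ext m
      exact hreg (LinearMap.congr_fun hab m)
    have Qs : Function.Surjective Q := fun f => by
      obtain ⟨y, hy⟩ := lift_of_ext_one x q w hS M hM1 f
      exact ⟨y, LinearMap.ext hy⟩
    have Qk : ∀ a, Q a = 0 → ∃ b, x • b = a := fun a ha => by
      have : ∀ m, ∃ b, x • b = a m := fun m => hk _ (LinearMap.congr_fun ha m)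
      choose b hb using this
      refine ⟨⟨⟨b, fun m n => hreg ?_⟩, fun c m => hreg ?_⟩, ?_⟩
      · simp [hb]
      · simp [hb, smul_comm x c]
      · ext m
        exact hb m
    have QExt := smulSC_ext_iff x Q Qw (smulSC_shortExact x Q Qw Qreg Qs Qk)
      (ModuleCat.of R (IsLocalRing.ResidueField R)) hx
    have hall : ∀ i < t + 1, Subsingleton (Abelian.Ext.{u}
        (ModuleCat.of R (IsLocalRing.ResidueField R)) (ModuleCat.of R (M →ₗ[R] N)) i) := by
      intro i hi
      induction i with
      | zero =>
        rw [ext_zero_iff]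
        exact Qreg.linearMap_subsingleton_of_mem_annihilator hx
      | succ i ihi => exact (QExt i (ihi (by omega))).mp (i2 i (by omega))
    refine ⟨Qs.nontrivial, hall, fun h => i3 ((QExt t (hall t (by omega))).mpr h)⟩

lemma exists_ext_residue_ne (R : Type u) [CommRing R] [IsLocalRing R] [IsNoetherianRing R]
    (N : Type u) [AddCommGroup N] [Module R N] [Module.Finite R N] [Nontrivial N] :
    ∃ n, ¬ Subsingleton (Abelian.Ext.{u} (ModuleCat.of R (IsLocalRing.ResidueField R))
      (ModuleCat.of R N) n) := by
  by_contra! h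
  have hs : Module.support R (IsLocalRing.ResidueField R) =
      PrimeSpectrum.zeroLocus (IsLocalRing.maximalIdeal R) := by
    change Module.support R (R ⧸ IsLocalRing.maximalIdeal R) = _
    rw [Module.support_eq_zeroLocus, Ideal.annihilator_quotient]
  have hlt : IsLocalRing.maximalIdeal R • (⊤ : Submodule R N) < ⊤ :=
    (Submodule.top_ne_ideal_smul_of_le_jacobson_annihilator
      (IsLocalRing.maximalIdeal_le_jacobson _)).symm.lt_top
  have key : ∀ n : ℕ, (n : WithBot ℕ∞) ≤ ringKrullDim R := fun n => by
    obtain ⟨rs, hl, hm, hr⟩ := ModuleCat.exists_isRegular_of_exists_subsingleton_ext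
      (IsLocalRing.maximalIdeal R) n (ModuleCat.of R N) hlt
      (ModuleCat.of R (IsLocalRing.ResidueField R)) hs (fun i _ => h i)
    have e := Module.supportDim_add_length_eq_supportDim_of_isRegular rs hr
    have := hr.quot_ofList_smul_nontrivial ⊤
    refine le_trans ?_ (Module.supportDim_le_ringKrullDim R N)
    rw [← e, hl]
    have hb : (0 : WithBot ℕ∞) ≤ Module.supportDim R
        (N ⧸ Ideal.ofList rs • (⊤ : Submodule R N)) := by
      obtain ⟨c, hc⟩ := WithBot.ne_bot_iff_exists.mp
        (Module.supportDim_ne_bot_of_nontrivial R (N ⧸ Ideal.ofList rs • (⊤ : Submodule R N)))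
      rw [← hc]
      exact WithBot.coe_le_coe.mpr bot_le
    simpa using add_le_add_left hb (n : WithBot ℕ∞)
  obtain ⟨c, hc⟩ := WithBot.ne_bot_iff_exists.mp (ringKrullDim_ne_bot (R := R))
  have htop := ringKrullDim_ne_top (R := R)
  rw [← hc] at key htop
  have hct : c ≠ ⊤ := fun h => htop (by rw [h]; rfl)
  obtain ⟨d, rfl⟩ := ENat.ne_top_iff_exists.mp hct
  have := key (d + 1)
  norm_cast at this
  omega

lemma moduleDepth_eq_iff (R : Type u) [CommRing R] [IsLocalRing R]
    (N : ModuleCat.{u} R) (t : ℕ)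
    (h1 : ∀ i < t, Subsingleton (Abelian.Ext.{u} (ModuleCat.of R (IsLocalRing.ResidueField R)) N i))
    (h2 : ¬ Subsingleton (Abelian.Ext.{u} (ModuleCat.of R (IsLocalRing.ResidueField R)) N t)) :
    moduleDepth R N = t := by
  refine IsLeast.csInf_eq ⟨⟨t, rfl, ?_⟩, ?_⟩
  · rwa [← not_subsingleton_iff_nontrivial, extMod_subsingleton_iff]
  · rintro _ ⟨n, rfl, hn⟩
    rw [← not_subsingleton_iff_nontrivial, extMod_subsingleton_iff] at hn
    by_contra hlt
    exact hn (h1 n (by simpa using hlt))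

end Aux

theorem stmt0 (R : Type u) [CommRing R] [IsLocalRing R] [IsNoetherianRing R]
    (M N : Type u) [AddCommGroup M] [Module R M] [AddCommGroup N] [Module R N]
    [Module.Finite R M] [Module.Finite R N] (hM : Nontrivial M) (hN : Nontrivial N)
    (hvan : ∀ i : ℕ, 1 ≤ i → (i : ℕ∞) ≤ moduleDepth R (ModuleCat.of R N) →
      Subsingleton (ExtMod R (ModuleCat.of R M) (ModuleCat.of R N) i)) :
    Nontrivial (M →ₗ[R] N) ∧
      moduleDepth R (ModuleCat.of R (M →ₗ[R] N)) = moduleDepth R (ModuleCat.of R N) := by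
  classical
  have hex := exists_ext_residue_ne R N
  have h2 := Nat.find_spec hex
  have h1 := fun i (hi : i < Nat.find hex) => not_not.mp (Nat.find_min hex hi)
  generalize Nat.find hex = t at h1 h2
  have hd := moduleDepth_eq_iff R (ModuleCat.of R N) t h1 h2
  rw [hd] at hvan ⊢
  obtain ⟨a, b, c⟩ := main_aux R M t N h1 h2
    (fun i hi hit => (extMod_subsingleton_iff _ _ _ _).mp (hvan i hi (by exact_mod_cast hit)))
  exact ⟨a, moduleDepth_eq_iff R _ t b c⟩
end

section
/- Let R be a Noetherian local ring, C a semidualizing R-module, t a nonnegative integer, and M, N finitely generated R-modules with Hom_R(M,N) and N both in the Auslander class A_C(R). If Ext^i_R(M,N) = 0 for all 1 ≤ i ≤ t, then Ext^i_R(M, C ⊗_R N) = 0 for all 1 ≤ i ≤ t. -/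
open CategoryTheory Opposite

universe u

section helpers

open TensorProduct

/-- Vanishing of the derived-category `Ext`. -/
def VE (R : Type u) [CommRing R] (M N : Type u) [AddCommGroup M] [Module R M]
    [AddCommGroup N] [Module R N] (i : ℕ) : Prop :=
  Subsingleton (Abelian.Ext.{u} (ModuleCat.of R M) (ModuleCat.of R N) i)

lemma extMod_crit (R : Type u) [CommRing R] (M N : ModuleCat.{u} R)
    (P : ProjectiveResolution M) (n : ℕ) :
    Subsingleton (ExtMod R M N (n+1)) ↔
      ∀ f : P.complex.X (n+1) ⟶ N, P.complex.d (n+2) (n+1) ≫ f = 0 →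
        ∃ g : P.complex.X n ⟶ N, P.complex.d (n+1) n ≫ g = f := by
  rw [← ModuleCat.isZero_iff_subsingleton]
  have h0 : Limits.IsZero (ExtMod R M N (n+1)) ↔
      Limits.IsZero ((P.complex.linearYonedaObj R N).homology (n+1)) :=
    (P.isoExt (R := R) (n+1) N).isZero_iff
  rw [h0, ← HomologicalComplex.exactAt_iff_isZero_homology,
    HomologicalComplex.exactAt_iff' _ n (n+1) (n+2) (by simp) (by simp),
    ShortComplex.moduleCat_exact_iff]
  exact Iff.rfl

lemma ve_crit (R : Type u) [CommRing R] (M N : ModuleCat.{u} R)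
    (P : ProjectiveResolution M) (n : ℕ) :
    Subsingleton (Abelian.Ext.{u} M N (n+1)) ↔
      ∀ f : P.complex.X (n+1) ⟶ N, P.complex.d (n+2) (n+1) ≫ f = 0 →
        ∃ g : P.complex.X n ⟶ N, P.complex.d (n+1) n ≫ g = f := by
  constructor
  · intro h f hf
    exact (P.extMk_eq_zero_iff f (n+2) rfl hf n rfl).1 (Subsingleton.elim _ _)
  · intro h
    refine subsingleton_of_forall_eq 0 fun α => ?_
    obtain ⟨f, hf, rfl⟩ := P.extMk_surjective α (n+2) rfl
    exact (P.extMk_eq_zero_iff f (n+2) rfl hf n rfl).2 (h f hf)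

lemma extMod_iff_ve (R : Type u) [CommRing R] (M N : Type u) [AddCommGroup M] [Module R M]
    [AddCommGroup N] [Module R N] (n : ℕ) :
    Subsingleton (ExtMod R (ModuleCat.of R M) (ModuleCat.of R N) (n+1)) ↔ VE R M N (n+1) := by
  rw [extMod_crit R _ _ (ProjectiveResolution.of _), VE,
    ve_crit R _ _ (ProjectiveResolution.of _)]

variable {R : Type u} [CommRing R]

lemma ve_pi {C A B : Type u} [AddCommGroup C] [Module R C] [AddCommGroup A] [Module R A]
    [AddCommGroup B] [Module R B] {n : ℕ} (e : A ≃ₗ[R] (Fin n → B)) (i : ℕ)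
    (h : VE R C B (i+1)) : VE R C A (i+1) := by
  unfold VE at *
  rw [ve_crit R _ _ (ProjectiveResolution.of _)] at *
  intro f hf
  have key : ∀ j : Fin n, ∃ g : (ProjectiveResolution.of (ModuleCat.of R C)).complex.X i ⟶
      ModuleCat.of R B,
      (ProjectiveResolution.of (ModuleCat.of R C)).complex.d (i+1) i ≫ g =
        f ≫ ModuleCat.ofHom ((LinearMap.proj j).comp e.toLinearMap) := by
    intro j
    apply h
    rw [← Category.assoc, hf, Limits.zero_comp]
  choose g hg using key
  refine ⟨ModuleCat.ofHom (e.symm.toLinearMap.comp (LinearMap.pi fun j => (g j).hom)), ?_⟩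
  ext x
  apply e.injective
  funext j
  have := congrArg (fun k => k.hom x) (hg j)
  simpa using this

section ses
variable {A B D : Type u} [AddCommGroup A] [Module R A] [AddCommGroup B] [Module R B]
  [AddCommGroup D] [Module R D]

lemma exists_ses (f : A →ₗ[R] B) (g : B →ₗ[R] D) (hf : Function.Injective f)
    (hg : Function.Surjective g) (hfg : Function.Exact f g) :
    ∃ S : ShortComplex (ModuleCat.{u} R), ∃ _ : S.ShortExact,
     S = ShortComplex.mk (ModuleCat.ofHom f) (ModuleCat.ofHom g)
       (by ext x; simpa using hfg.apply_apply_eq_zero x) := by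
  refine ⟨_, ?_, rfl⟩
  refine { exact := ?_, mono_f := ?_, epi_g := ?_ }
  · rw [ShortComplex.moduleCat_exact_iff]
    exact fun x hx => (hfg x).1 hx
  · exact (ModuleCat.mono_iff_injective _).2 hf
  · exact (ModuleCat.epi_iff_surjective _).2 hg

/-- covariant shifting -/
lemma ve_cov {C : Type u} [AddCommGroup C] [Module R C]
    (f : A →ₗ[R] B) (g : B →ₗ[R] D) (hf : Function.Injective f)
    (hg : Function.Surjective g) (hfg : Function.Exact f g) (i : ℕ)
    (h1 : VE R C B i) (h2 : VE R C A (i+1)) : VE R C D i := by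
  obtain ⟨S, hS, rfl⟩ := exists_ses f g hf hg hfg
  unfold VE at *
  refine subsingleton_of_forall_eq 0 fun x => ?_
  obtain ⟨y, rfl⟩ := Abelian.Ext.covariant_sequence_exact₃ _ hS x rfl
    (@Subsingleton.elim _ h2 _ _)
  rw [@Subsingleton.elim _ h1 y 0, Abelian.Ext.zero_comp]

lemma ve_lift {C : Type u} [AddCommGroup C] [Module R C]
    (f : A →ₗ[R] B) (g : B →ₗ[R] D) (hf : Function.Injective f)
    (hg : Function.Surjective g) (hfg : Function.Exact f g)
    (h2 : VE R C A 1) (φ : C →ₗ[R] D) : ∃ ψ : C →ₗ[R] B, g ∘ₗ ψ = φ := by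
  obtain ⟨S, hS, rfl⟩ := exists_ses f g hf hg hfg
  unfold VE at *
  obtain ⟨y, hy⟩ := Abelian.Ext.covariant_sequence_exact₃ _ hS
    (Abelian.Ext.mk₀ (ModuleCat.ofHom φ)) (zero_add 1) (@Subsingleton.elim _ h2 _ _)
  obtain ⟨y, rfl⟩ := (Abelian.Ext.mk₀_bijective _ _).2 y
  rw [Abelian.Ext.mk₀_comp_mk₀] at hy
  have := (Abelian.Ext.mk₀_bijective _ _).1 hy
  exact ⟨y.hom, congrArg ModuleCat.Hom.hom this⟩

lemma ve_ext {N : Type u} [AddCommGroup N] [Module R N]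
    (f : A →ₗ[R] B) (g : B →ₗ[R] D) (hf : Function.Injective f)
    (hg : Function.Surjective g) (hfg : Function.Exact f g)
    (h2 : VE R D N 1) (φ : A →ₗ[R] N) : ∃ ψ : B →ₗ[R] N, ψ ∘ₗ f = φ := by
  obtain ⟨S, hS, rfl⟩ := exists_ses f g hf hg hfg
  unfold VE at *
  obtain ⟨y, hy⟩ := Abelian.Ext.contravariant_sequence_exact₁ hS _
    (Abelian.Ext.mk₀ (ModuleCat.ofHom φ)) (add_zero 1) (@Subsingleton.elim _ h2 _ _)
  obtain ⟨y, rfl⟩ := (Abelian.Ext.mk₀_bijective _ _).2 y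
  rw [Abelian.Ext.mk₀_comp_mk₀] at hy
  have := (Abelian.Ext.mk₀_bijective _ _).1 hy
  exact ⟨y.hom, congrArg ModuleCat.Hom.hom this⟩

lemma ve_one_of_ext {N : Type u} [AddCommGroup N] [Module R N] [Module.Projective R B]
    (f : A →ₗ[R] B) (g : B →ₗ[R] D) (hf : Function.Injective f)
    (hg : Function.Surjective g) (hfg : Function.Exact f g)
    (h : ∀ φ : A →ₗ[R] N, ∃ ψ : B →ₗ[R] N, ψ ∘ₗ f = φ) : VE R D N 1 := by
  obtain ⟨S, hS, rfl⟩ := exists_ses f g hf hg hfg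
  have : Projective (ModuleCat.of R B) := (IsProjective.iff_projective B).1 inferInstance
  unfold VE
  refine subsingleton_of_forall_eq 0 fun x => ?_
  obtain ⟨y, rfl⟩ := Abelian.Ext.contravariant_sequence_exact₃ hS _ x
    (Abelian.Ext.eq_zero_of_projective (P := ModuleCat.of R B) _) (add_zero 1)
  obtain ⟨y, rfl⟩ := (Abelian.Ext.mk₀_bijective _ _).2 y
  obtain ⟨ψ, hψ⟩ := h y.hom
  have : y = ModuleCat.ofHom f ≫ ModuleCat.ofHom ψ := by
    ext x; simp [← hψ]
  rw [this, ← Abelian.Ext.mk₀_comp_mk₀]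
  exact hS.extClass_comp_assoc _

lemma ve_shift {N : Type u} [AddCommGroup N] [Module R N] [Module.Projective R B]
    (f : A →ₗ[R] B) (g : B →ₗ[R] D) (hf : Function.Injective f)
    (hg : Function.Surjective g) (hfg : Function.Exact f g) (i : ℕ) :
    VE R D N (i+2) ↔ VE R A N (i+1) := by
  obtain ⟨S, hS, rfl⟩ := exists_ses f g hf hg hfg
  have : Projective (ModuleCat.of R B) := (IsProjective.iff_projective B).1 inferInstance
  unfold VE
  constructor
  · intro h
    refine subsingleton_of_forall_eq 0 fun x => ?_
    obtain ⟨y, rfl⟩ := Abelian.Ext.contravariant_sequence_exact₁ hS _ x (by omega : 1 + (i+1) = i+2)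
      (@Subsingleton.elim _ h _ _)
    rw [Abelian.Ext.eq_zero_of_projective (P := ModuleCat.of R B) y, Abelian.Ext.comp_zero]
  · intro h
    refine subsingleton_of_forall_eq 0 fun x => ?_
    obtain ⟨y, rfl⟩ := Abelian.Ext.contravariant_sequence_exact₃ hS _ x
      (Abelian.Ext.eq_zero_of_projective (P := ModuleCat.of R B) _) (by omega : 1 + (i+1) = i+2)
    rw [@Subsingleton.elim _ h y 0, Abelian.Ext.comp_zero]

end ses

/-- The part of the Auslander class used in the argument. -/
def GC (R : Type u) [CommRing R] (C X : Type u) [AddCommGroup C] [Module R C]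
    [AddCommGroup X] [Module R X] : Prop :=
  Function.Bijective ((TensorProduct.mk R C X).flip) ∧ ∀ i : ℕ, VE R C (C ⊗[R] X) (i+1)

lemma gc_pi {C N Z : Type u} [AddCommGroup C] [Module R C] [AddCommGroup N] [Module R N]
    [AddCommGroup Z] [Module R Z] {n : ℕ} (e : Z ≃ₗ[R] (Fin n → N)) (h : GC R C N) :
    GC R C Z := by
  let E : C ⊗[R] Z ≃ₗ[R] (Fin n → C ⊗[R] N) :=
    (TensorProduct.congr (LinearEquiv.refl R C) e).trans (TensorProduct.piRight R R C _)
  have hE : ∀ c z j, E (c ⊗ₜ z) j = c ⊗ₜ (e z j) := by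
    intro c z j; simp [E]
  refine ⟨⟨?_, ?_⟩, fun i => ve_pi E i (h.2 i)⟩
  · rw [injective_iff_map_eq_zero]
    intro z hz
    apply e.injective
    funext j
    rw [map_zero]
    apply h.1.1
    ext c
    have := congrArg (fun k : C →ₗ[R] C ⊗[R] Z => E (k c) j) hz
    simpa [hE] using this
  · intro g
    choose x hx using fun j => h.1.2 ((LinearMap.proj j).comp (E.toLinearMap.comp g))
    refine ⟨e.symm x, ?_⟩
    ext c
    apply E.injective
    funext j
    have := congrArg (fun k : C →ₗ[R] C ⊗[R] N => k c) (hx j)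
    simpa [hE] using this

section noeth
variable [IsNoetherianRing R] {C : Type u} [AddCommGroup C] [Module R C] [Module.Finite R C]

lemma inj_lTensor (hfaith : Module.annihilator R C = ⊥)
    {X Y : Type u} [AddCommGroup X] [Module R X] [Module.Finite R X]
    [AddCommGroup Y] [Module R Y] (hX : GC R C X) (hY : GC R C Y) (f : X →ₗ[R] Y)
    (hf : Function.Injective f) : Function.Injective (f.lTensor C) := by
  rw [← LinearMap.ker_eq_bot]
  have hs : Subsingleton (C →ₗ[R] LinearMap.ker (f.lTensor C)) := by
    refine subsingleton_of_forall_eq 0 fun g => ?_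
    obtain ⟨x, hx⟩ := hX.1.2 ((LinearMap.ker (f.lTensor C)).subtype ∘ₗ g)
    have hx' : ∀ c, c ⊗ₜ[R] x = (g c : C ⊗[R] X) := fun c => congrArg (fun k => k c) hx
    have : f x = 0 := by
      apply hY.1.1
      ext c
      have := (g c).2
      rw [← hx', LinearMap.mem_ker] at this
      simpa using this
    have hx0 : x = 0 := hf (by simpa using this)
    ext c
    rw [← hx', hx0]; simp
  obtain ⟨r, hr, hreg⟩ := IsSMulRegular.subsingleton_linearMap_iff.1 hs
  rw [hfaith, Ideal.mem_bot] at hr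
  subst hr
  rw [eq_bot_iff]
  intro k hk
  have := @hreg ⟨k, hk⟩ 0 (by simp)
  simpa using this

lemma gc_coker (hfaith : Module.annihilator R C = ⊥)
    {X Y Z : Type u} [AddCommGroup X] [Module R X] [Module.Finite R X]
    [AddCommGroup Y] [Module R Y] [AddCommGroup Z] [Module R Z] (hX : GC R C X) (hY : GC R C Y)
    (f : X →ₗ[R] Y) (g : Y →ₗ[R] Z)
    (hf : Function.Injective f) (hg : Function.Surjective g) (hfg : Function.Exact f g) :
    GC R C Z := by
  have hf' := inj_lTensor hfaith hX hY f hf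
  have hg' := LinearMap.lTensor_surjective C hg
  have hfg' := lTensor_exact C hfg hg
  refine ⟨⟨?_, ?_⟩, fun i => ve_cov _ _ hf' hg' hfg' _ (hY.2 i) (hX.2 (i+1))⟩
  · rw [injective_iff_map_eq_zero]
    intro z hz
    obtain ⟨y, rfl⟩ := hg z
    have h0 : ∀ c, g.lTensor C (c ⊗ₜ y) = 0 := fun c => by
      have := congrArg (fun k : C →ₗ[R] C ⊗[R] Z => k c) hz
      simpa using this
    -- the map `C → C ⊗ Y` lands in `C ⊗ X`
    let eX := LinearEquiv.ofInjective (f.lTensor C) hf'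
    have hm : ∀ c, c ⊗ₜ[R] y ∈ LinearMap.range (f.lTensor C) := fun c => (hfg' _).1 (h0 c)
    let φ : C →ₗ[R] C ⊗[R] X := eX.symm.toLinearMap ∘ₗ
      (((TensorProduct.mk R C Y).flip y).codRestrict _ hm)
    have hφ : ∀ c, f.lTensor C (φ c) = c ⊗ₜ y := by
      intro c
      have : eX (φ c) = ⟨c ⊗ₜ y, hm c⟩ := by
        simp only [φ, LinearMap.comp_apply, LinearEquiv.coe_coe, LinearEquiv.apply_symm_apply]
        rfl
      have := congrArg Subtype.val this
      simpa [eX] using this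
    obtain ⟨x, hx⟩ := hX.1.2 φ
    have : f x = y := by
      apply hY.1.1
      ext c
      have h3 := hφ c
      rw [← hx] at h3
      simpa using h3
    rw [← this]
    exact hfg.apply_apply_eq_zero x
  · intro φ
    obtain ⟨ψ, rfl⟩ := ve_lift _ _ hf' hg' hfg' (hX.2 0) φ
    obtain ⟨y, rfl⟩ := hY.1.2 ψ
    exact ⟨g y, by ext c; simp⟩

/-- precomposition as a linear map -/
abbrev pc {R : Type u} [CommRing R] {A B : Type u} [AddCommGroup A] [Module R A]
    [AddCommGroup B] [Module R B] (f : A →ₗ[R] B) (N : Type u) [AddCommGroup N] [Module R N] :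
    (B →ₗ[R] N) →ₗ[R] (A →ₗ[R] N) := LinearMap.lcomp R N f

lemma theta_nat {A B N : Type u} [AddCommGroup A] [Module R A]
    [AddCommGroup B] [Module R B] [AddCommGroup N] [Module R N] (f : A →ₗ[R] B)
    (x : C ⊗[R] (B →ₗ[R] N)) :
    lTensorHomToHomLTensor (.id R) A C N ((pc f N).lTensor C x) =
      (lTensorHomToHomLTensor (.id R) B C N x) ∘ₗ f := by
  induction x with
  | zero => simp
  | add x y hx hy => simp [hx, hy, LinearMap.add_comp]
  | tmul c g => ext a; simp

lemma theta_free (n : ℕ) (N : Type u) [AddCommGroup N] [Module R N] :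
    Function.Bijective (lTensorHomToHomLTensor (.id R) (Fin n → R) C N) := by
  have := (lTensorHomEquivHomLTensor R (Fin n → R) C N).bijective
  convert this using 1
  ext x
  rw [lTensorHomEquivHomLTensor_apply]

lemma theta_surj (hfaith : Module.annihilator R C = ⊥)
    {K N : Type u} [AddCommGroup K] [Module R K] [Module.Finite R K]
    [AddCommGroup N] [Module R N] [Module.Finite R N] (hN : GC R C N)
    (hK : GC R C (K →ₗ[R] N)) :
    Function.Surjective (lTensorHomToHomLTensor (.id R) K C N) := by
  intro φ
  obtain ⟨n, p, hp⟩ := Module.Finite.exists_fin' R K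
  obtain ⟨m, q', hq'⟩ := Module.Finite.exists_fin' R (LinearMap.ker p)
  let q : (Fin m → R) →ₗ[R] (Fin n → R) := (LinearMap.ker p).subtype ∘ₗ q'
  have hpq : p ∘ₗ q = 0 := by ext x; simp [q]
  have hF : ∀ k : ℕ, GC R C ((Fin k → R) →ₗ[R] N) := fun k =>
    gc_pi (Module.piEquiv (Fin k) R N).symm hN
  let a := pc p N
  let b := (pc q N).rangeRestrict
  let ι := (LinearMap.range (pc q N)).subtype
  have ha : Function.Injective a := fun x y h => by
    ext k
    obtain ⟨k, rfl⟩ := hp k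
    exact congrArg (fun l => l k) h
  have hb : Function.Surjective b := LinearMap.surjective_rangeRestrict _
  have hab : Function.Exact a b := by
    intro y
    constructor
    · intro hy
      have hy' : y ∘ₗ q = 0 := congrArg Subtype.val hy
      have hker : LinearMap.ker p ≤ LinearMap.ker y := by
        intro z hz
        obtain ⟨w, hw⟩ := hq' ⟨z, hz⟩
        have : y (q w) = 0 := congrArg (fun l => l w) hy'
        simpa [q, hw] using this
      let e := p.quotKerEquivOfSurjective hp
      refine ⟨((LinearMap.ker p).liftQ y hker) ∘ₗ e.symm.toLinearMap, ?_⟩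
      refine LinearMap.ext fun z => ?_
      have : e.symm (p z) = (LinearMap.ker p).mkQ z := by
        rw [LinearEquiv.symm_apply_eq]; rfl
      simp [a, this]
    · rintro ⟨x, rfl⟩
      apply Subtype.ext
      change (x ∘ₗ p) ∘ₗ q = 0
      rw [LinearMap.comp_assoc, hpq, LinearMap.comp_zero]
  have hB : GC R C (LinearMap.range (pc q N)) := gc_coker hfaith hK (hF n) a b ha hb hab
  have hι := inj_lTensor hfaith hB (hF m) ι Subtype.val_injective
  obtain ⟨x, hx⟩ := (theta_free (C := C) n N).2 (φ ∘ₗ p)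
  have h0 : (pc q N).lTensor C x = 0 := by
    apply (theta_free (C := C) m N).1
    rw [theta_nat, hx, LinearMap.comp_assoc, hpq]; simp
  have h1 : b.lTensor C x = 0 := by
    apply hι
    rw [map_zero, ← LinearMap.comp_apply, ← LinearMap.lTensor_comp]
    exact h0
  obtain ⟨y, rfl⟩ := (lTensor_exact C hab hb x).1 h1
  refine ⟨y, ?_⟩
  rw [theta_nat] at hx
  ext k
  obtain ⟨k, rfl⟩ := hp k
  exact congrArg (fun l => l k) hx

theorem main_aux_s2 (hfaith : Module.annihilator R C = ⊥)
    {N : Type u} [AddCommGroup N] [Module R N] [Module.Finite R N]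
    (hN : GC R C N) (t : ℕ) :
    ∀ (M : Type u) [AddCommGroup M] [Module R M] [Module.Finite R M], GC R C (M →ₗ[R] N) →
      (∀ i < t, VE R M N (i+1)) → ∀ i < t, VE R M (C ⊗[R] N) (i+1) := by
  induction t with
  | zero => intro M _ _ _ _ _ i hi; omega
  | succ t ih =>
    intro M _ _ _ hM hv
    obtain ⟨n, p, hp⟩ := Module.Finite.exists_fin' R M
    let ι := (LinearMap.ker p).subtype
    have hι : Function.Injective ι := Subtype.val_injective
    have hιp : Function.Exact ι p := LinearMap.exact_subtype_ker_map p
    have hF : GC R C ((Fin n → R) →ₗ[R] N) := gc_pi (Module.piEquiv (Fin n) R N).symm hN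
    have hsurj : Function.Surjective (pc ι N) := fun φ =>
      ve_ext ι p hι hp hιp (hv 0 (by omega)) φ
    have hinj : Function.Injective (pc p N) := fun x y h => by
      ext k
      obtain ⟨k, rfl⟩ := hp k
      exact congrArg (fun l => l k) h
    have hex : Function.Exact (pc p N) (pc ι N) := by
      intro y
      constructor
      · intro hy
        have hker : LinearMap.ker p ≤ LinearMap.ker y := fun z hz =>
          congrArg (fun l : LinearMap.ker p →ₗ[R] N => l ⟨z, hz⟩) hy
        let e := p.quotKerEquivOfSurjective hp
        refine ⟨((LinearMap.ker p).liftQ y hker) ∘ₗ e.symm.toLinearMap, ?_⟩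
        refine LinearMap.ext fun z => ?_
        have : e.symm (p z) = (LinearMap.ker p).mkQ z := by
          rw [LinearEquiv.symm_apply_eq]; rfl
        simp [this]
      · rintro ⟨x, rfl⟩
        ext ⟨z, hz⟩
        have hz' : p z = 0 := hz
        simp [ι, hz']
    have hK : GC R C (LinearMap.ker p →ₗ[R] N) :=
      gc_coker hfaith hM hF (pc p N) (pc ι N) hinj hsurj hex
    intro i hi
    cases i with
    | zero =>
      refine ve_one_of_ext ι p hι hp hιp fun φ => ?_
      obtain ⟨x, rfl⟩ := theta_surj hfaith hN hK φ
      obtain ⟨y, rfl⟩ := LinearMap.lTensor_surjective C hsurj x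
      exact ⟨_, (theta_nat ι y).symm⟩
    | succ i =>
      rw [ve_shift ι p hι hp hιp]
      refine ih _ hK (fun j hj => ?_) i (by omega)
      rw [← ve_shift ι p hι hp hιp]
      exact hv (j+1) (by omega)

end noeth

end helpers

theorem stmt2 (R : Type u) [CommRing R] [IsLocalRing R] [IsNoetherianRing R]
    (C M N : Type u) [AddCommGroup C] [Module R C] [AddCommGroup M] [Module R M]
    [AddCommGroup N] [Module R N] [Module.Finite R M] [Module.Finite R N]
    (hC : Semidualizing R C) (t : ℕ)
    (h1 : InAuslanderClass R C (M →ₗ[R] N)) (h2 : InAuslanderClass R C N)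
    (hvan : ∀ i : ℕ, 1 ≤ i → i ≤ t →
      Subsingleton (ExtMod R (ModuleCat.of R M) (ModuleCat.of R N) i)) :
    ∀ i : ℕ, 1 ≤ i → i ≤ t →
      Subsingleton (ExtMod R (ModuleCat.of R M) (ModuleCat.of R (TensorProduct R C N)) i) := by
  have hfin : Module.Finite R C := hC.1
  have hfaith : Module.annihilator R C = ⊥ := by
    rw [eq_bot_iff]
    intro r hr
    rw [Module.mem_annihilator] at hr
    rw [Ideal.mem_bot]
    apply hC.2.1.1
    ext c
    simpa using hr c
  have hG : ∀ (X : Type u) [AddCommGroup X] [Module R X], InAuslanderClass R C X → GC R C X :=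
    fun X _ _ h => ⟨h.1, fun i => (extMod_iff_ve R _ _ i).1 (h.2.2 (i+1) (by omega))⟩
  intro i hi hit
  obtain ⟨i, rfl⟩ : ∃ j, i = j + 1 := ⟨i - 1, by omega⟩
  rw [extMod_iff_ve]
  exact main_aux_s2 hfaith (hG N h2) t M (hG _ h1)
    (fun j hj => (extMod_iff_ve R _ _ j).1 (hvan (j+1) (by omega) (by omega))) i (by omega)
end

section
/- Let R be a Cohen-Macaulay local ring of dimension d ≥ 2, let 1 ≤ n ≤ d−1 be an integer, and let M be a finitely generated R-module such that M_p has finite projective dimension over R_p for every prime p of height at most n, and such that the dual M* = Hom_R(M,R) has finite Gorenstein dimension. If Ext^i_R(M,R) = 0 for all 1 ≤ i ≤ d and Ext^j_R(M,M) = 0 for all n ≤ j ≤ d−1, then M is free. -/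
open CategoryTheory Opposite

universe u

namespace S3

section layer
variable {R : Type u} [CommRing R]
variable {N N' N'' X Y Z : Type u} [AddCommGroup N] [Module R N] [AddCommGroup N'] [Module R N']
  [AddCommGroup N''] [Module R N'']
  [AddCommGroup X] [Module R X] [AddCommGroup Y] [Module R Y] [AddCommGroup Z] [Module R Z]

/-- Ext groups of modules. -/
abbrev EE (R : Type u) [CommRing R] (N X : Type u) [AddCommGroup N] [Module R N]
    [AddCommGroup X] [Module R X] (i : ℕ) : Type u :=
  Abelian.Ext.{u} (ModuleCat.of R N) (ModuleCat.of R X) i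

/-- Covariant functoriality of Ext. -/
noncomputable def push (N : Type u) [AddCommGroup N] [Module R N] (f : X →ₗ[R] Y) (i : ℕ) :
    EE R N X i →ₗ[R] EE R N Y i where
  toFun ξ := ξ.comp (Abelian.Ext.mk₀ (ModuleCat.ofHom f)) (add_zero i)
  map_add' := by intros; simp
  map_smul' := by intros; simp

/-- Contravariant functoriality of Ext. -/
noncomputable def pull (g : N' →ₗ[R] N) (X : Type u) [AddCommGroup X] [Module R X] (i : ℕ) :
    EE R N X i →ₗ[R] EE R N' X i where
  toFun ξ := (Abelian.Ext.mk₀ (ModuleCat.ofHom g)).comp ξ (zero_add i)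
  map_add' := by intros; simp
  map_smul' := by intros; simp

lemma push_push (f : X →ₗ[R] Y) (g : Y →ₗ[R] Z) (i : ℕ) (ξ : EE R N X i) :
    push N g i (push N f i ξ) = push N (g ∘ₗ f) i ξ := by
  simp [push]

lemma pull_pull (f : N'' →ₗ[R] N') (g : N' →ₗ[R] N) (i : ℕ) (ξ : EE R N X i) :
    pull f X i (pull g X i ξ) = pull (g ∘ₗ f) X i ξ := by
  simp [pull]

lemma pull_push (g : N' →ₗ[R] N) (f : X →ₗ[R] Y) (i : ℕ) (ξ : EE R N X i) :
    pull g Y i (push N f i ξ) = push N' f i (pull g X i ξ) := by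
  simp [pull, push]

lemma push_id (i : ℕ) (ξ : EE R N X i) : push N (LinearMap.id : X →ₗ[R] X) i ξ = ξ := by
  simp [push]

lemma pull_id (i : ℕ) (ξ : EE R N X i) : pull (LinearMap.id : N →ₗ[R] N) X i ξ = ξ := by
  simp [pull]

lemma push_add (f g : X →ₗ[R] Y) (i : ℕ) (ξ : EE R N X i) :
    push N (f + g) i ξ = push N f i ξ + push N g i ξ := by
  simp [push, ModuleCat.ofHom_add, Abelian.Ext.mk₀_add]

lemma push_smul (r : R) (f : X →ₗ[R] Y) (i : ℕ) (ξ : EE R N X i) :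
    push N (r • f) i ξ = r • push N f i ξ := by
  have : ModuleCat.ofHom (r • f) = r • ModuleCat.ofHom f := rfl
  simp [push, this, Abelian.Ext.mk₀_smul]

lemma push_zero (i : ℕ) (ξ : EE R N X i) :
    push N (0 : X →ₗ[R] Y) i ξ = 0 := by
  have := push_smul (0 : R) (0 : X →ₗ[R] Y) i ξ
  simpa using this

lemma pull_smul (r : R) (g : N' →ₗ[R] N) (i : ℕ) (ξ : EE R N X i) :
    pull (r • g) X i ξ = r • pull g X i ξ := by
  have : ModuleCat.ofHom (r • g) = r • ModuleCat.ofHom g := rfl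
  simp [pull, this, Abelian.Ext.mk₀_smul]

lemma pull_zero (i : ℕ) (ξ : EE R N X i) :
    pull (0 : N' →ₗ[R] N) X i ξ = 0 := by
  have := pull_smul (0 : R) (0 : N' →ₗ[R] N) i ξ
  simpa using this

lemma push_sum {ι : Type*} (s : Finset ι) (f : ι → (X →ₗ[R] Y)) (i : ℕ) (ξ : EE R N X i) :
    push N (∑ j ∈ s, f j) i ξ = ∑ j ∈ s, push N (f j) i ξ := by
  classical
  induction s using Finset.induction_on with
  | empty => simp [push_zero]
  | insert a s ha ih => simp [Finset.sum_insert ha, push_add, ih]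

/-- An element killing the source kills Ext. -/
lemma smul_eq_zero_of_src (r : R) (h : ∀ n : N, r • n = 0) (i : ℕ) (ξ : EE R N X i) :
    r • ξ = 0 := by
  have h0 : r • (LinearMap.id : N →ₗ[R] N) = 0 := by ext n; simpa using h n
  have := pull_smul r (LinearMap.id : N →ₗ[R] N) i ξ
  rw [h0, pull_zero, pull_id] at this
  exact this.symm

/-- Degree zero Ext is Hom. -/
noncomputable def hom0 (f : N →ₗ[R] X) : EE R N X 0 := Abelian.Ext.mk₀ (ModuleCat.ofHom f)

lemma hom0_surj (ξ : EE R N X 0) : ∃ f : N →ₗ[R] X, hom0 f = ξ := by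
  obtain ⟨f, hf⟩ := (Abelian.Ext.mk₀_bijective _ _).2 ξ
  exact ⟨f.hom, hf⟩

lemma hom0_inj {f g : N →ₗ[R] X} (h : hom0 f = hom0 g) : f = g := by
  have := (Abelian.Ext.mk₀_bijective _ _).1 h
  simpa using congrArg ModuleCat.Hom.hom this

lemma push_hom0 (f : N →ₗ[R] X) (g : X →ₗ[R] Y) : push N g 0 (hom0 f) = hom0 (g ∘ₗ f) := by
  simp [push, hom0]

lemma pull_hom0 (f : N →ₗ[R] X) (g : N' →ₗ[R] N) : pull g X 0 (hom0 f) = hom0 (f ∘ₗ g) := by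
  simp [pull, hom0]

lemma hom0_zero : hom0 (0 : N →ₗ[R] X) = 0 := by
  have : ModuleCat.ofHom (0 : N →ₗ[R] X) = 0 := rfl
  simp [hom0, this]

lemma sub0 : Subsingleton (EE R N X 0) ↔ ∀ f : N →ₗ[R] X, f = 0 := by
  constructor
  · intro h f
    exact hom0_inj (Subsingleton.elim _ _)
  · intro h
    refine ⟨fun a b => ?_⟩
    obtain ⟨f, rfl⟩ := hom0_surj a
    obtain ⟨g, rfl⟩ := hom0_surj b
    rw [h f, h g]

/-- short complex -/
abbrev sc (f : X →ₗ[R] Y) (g : Y →ₗ[R] Z) (h : Function.Exact f g) :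
    ShortComplex (ModuleCat.{u} R) :=
  ShortComplex.mk (ModuleCat.ofHom f) (ModuleCat.ofHom g) (by
    ext x; exact h.apply_apply_eq_zero x)

lemma sc_exact (f : X →ₗ[R] Y) (g : Y →ₗ[R] Z) (h : Function.Exact f g)
    (hf : Function.Injective f) (hg : Function.Surjective g) : (sc f g h).ShortExact where
  exact := (ShortComplex.ShortExact.moduleCat_exact_iff_function_exact _).2 h
  mono_f := (ModuleCat.mono_iff_injective _).2 hf
  epi_g := (ModuleCat.epi_iff_surjective _).2 hg

/-- Bundled short exact sequences. -/
structure SES (f : X →ₗ[R] Y) (g : Y →ₗ[R] Z) : Prop where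
  inj : Function.Injective f
  ex : Function.Exact f g
  surj : Function.Surjective g

/-- extension class -/
noncomputable def SES.cls {f : X →ₗ[R] Y} {g : Y →ₗ[R] Z} (h : SES f g) : EE R Z X 1 :=
  (sc_exact f g h.ex h.inj h.surj).extClass

/-- covariant connecting map -/
noncomputable def SES.δ {f : X →ₗ[R] Y} {g : Y →ₗ[R] Z} (h : SES f g) (N : Type u)
    [AddCommGroup N] [Module R N] (i : ℕ) : EE R N Z i →ₗ[R] EE R N X (i + 1) where
  toFun ξ := ξ.comp h.cls rfl
  map_add' := by intros; simp
  map_smul' := by intros; simp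

/-- contravariant connecting map -/
noncomputable def SES.ε {f : X →ₗ[R] Y} {g : Y →ₗ[R] Z} (h : SES f g) (N : Type u)
    [AddCommGroup N] [Module R N] (i : ℕ) : EE R X N i →ₗ[R] EE R Z N (i + 1) where
  toFun ξ := h.cls.comp ξ (add_comm 1 i)
  map_add' := by intros; simp
  map_smul' := by intros; simp

section
variable {f : X →ₗ[R] Y} {g : Y →ₗ[R] Z} (h : SES f g)
include h

lemma SES.cov1 {i : ℕ} (ξ : EE R N X (i + 1)) (hξ : push N f (i + 1) ξ = 0) :
    ∃ ζ : EE R N Z i, h.δ N i ζ = ξ :=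
  Abelian.Ext.covariant_sequence_exact₁ _ (sc_exact f g h.ex h.inj h.surj) ξ hξ rfl

lemma SES.cov2 {i : ℕ} (ξ : EE R N Y i) (hξ : push N g i ξ = 0) :
    ∃ ζ : EE R N X i, push N f i ζ = ξ :=
  Abelian.Ext.covariant_sequence_exact₂ _ (sc_exact f g h.ex h.inj h.surj) ξ hξ

lemma SES.cov3 {i : ℕ} (ξ : EE R N Z i) (hξ : h.δ N i ξ = 0) :
    ∃ ζ : EE R N Y i, push N g i ζ = ξ :=
  Abelian.Ext.covariant_sequence_exact₃ _ (sc_exact f g h.ex h.inj h.surj) ξ rfl hξ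

lemma SES.con1 {i : ℕ} (ξ : EE R X N i) (hξ : h.ε N i ξ = 0) :
    ∃ ζ : EE R Y N i, pull f N i ζ = ξ :=
  Abelian.Ext.contravariant_sequence_exact₁ (sc_exact f g h.ex h.inj h.surj) _ ξ (add_comm 1 i) hξ

lemma SES.con2 {i : ℕ} (ξ : EE R Y N i) (hξ : pull f N i ξ = 0) :
    ∃ ζ : EE R Z N i, pull g N i ζ = ξ :=
  Abelian.Ext.contravariant_sequence_exact₂ (sc_exact f g h.ex h.inj h.surj) _ ξ hξ

lemma SES.con3 {i : ℕ} (ξ : EE R Z N (i + 1)) (hξ : pull g N (i + 1) ξ = 0) :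
    ∃ ζ : EE R X N i, h.ε N i ζ = ξ :=
  Abelian.Ext.contravariant_sequence_exact₃ (sc_exact f g h.ex h.inj h.surj) _ ξ hξ (add_comm 1 i)

lemma SES.pull_ε {i : ℕ} (ξ : EE R X N i) : pull g N (i + 1) (h.ε N i ξ) = 0 :=
  (sc_exact f g h.ex h.inj h.surj).comp_extClass_assoc ξ (add_comm 1 i)

lemma SES.ε_pull {i : ℕ} (ξ : EE R Y N i) : h.ε N i (pull f N i ξ) = 0 :=
  (sc_exact f g h.ex h.inj h.surj).extClass_comp_assoc ξ (h := add_comm 1 i)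

lemma SES.pull_δ {i : ℕ} (k : N' →ₗ[R] N) (ζ : EE R N Z i) :
    pull k X (i + 1) (h.δ N i ζ) = h.δ N' i (pull k Z i ζ) := by
  simp only [pull, SES.δ, LinearMap.coe_mk, AddHom.coe_mk]
  rw [Abelian.Ext.comp_assoc _ _ _ _ _ (by omega)]

end

/-- naturality of the contravariant connecting map -/
lemma SES.pull_ε_nat {X' Y' Z' : Type u} [AddCommGroup X'] [Module R X'] [AddCommGroup Y']
    [Module R Y'] [AddCommGroup Z'] [Module R Z']
    {f : X →ₗ[R] Y} {g : Y →ₗ[R] Z} (h : SES f g)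
    {f' : X' →ₗ[R] Y'} {g' : Y' →ₗ[R] Z'} (h' : SES f' g')
    (a : X' →ₗ[R] X) (b : Y' →ₗ[R] Y) (c : Z' →ₗ[R] Z)
    (h1 : f ∘ₗ a = b ∘ₗ f') (h2 : g ∘ₗ b = c ∘ₗ g') {i : ℕ} (ξ : EE R X N i) :
    pull c N (i + 1) (h.ε N i ξ) = h'.ε N i (pull a N i ξ) := by
  have := ShortComplex.ShortExact.extClass_naturality
    (sc_exact f' g' h'.ex h'.inj h'.surj) (sc_exact f g h.ex h.inj h.surj)
    { τ₁ := ModuleCat.ofHom a, τ₂ := ModuleCat.ofHom b, τ₃ := ModuleCat.ofHom c,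
      comm₁₂ := by ext x; exact LinearMap.congr_fun h1 x
      comm₂₃ := by ext x; exact LinearMap.congr_fun h2 x }
  simp only [pull, SES.ε, LinearMap.coe_mk, AddHom.coe_mk, SES.cls] at this ⊢
  rw [← Abelian.Ext.comp_assoc _ _ _ (zero_add 1) _ (by omega), ← this,
    Abelian.Ext.comp_assoc_of_second_deg_zero]

lemma sub_proj [Module.Projective R N] (i : ℕ) : Subsingleton (EE R N X (i + 1)) := by
  have : Projective (ModuleCat.of R N) := (IsProjective.iff_projective N).1 inferInstance
  exact Abelian.Ext.subsingleton_of_projective _ _ _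

lemma push_inj0 (f : X →ₗ[R] Y) (hf : Function.Injective f) (ξ : EE R N X 0)
    (h : push N f 0 ξ = 0) : ξ = 0 := by
  obtain ⟨a, rfl⟩ := hom0_surj ξ
  rw [push_hom0, ← hom0_zero] at h
  have := hom0_inj h
  rw [show a = 0 from ?_, hom0_zero]
  ext x; apply hf; simpa using LinearMap.congr_fun this x

/-- kernels give short exact sequences -/
lemma ses_ker (g : Y →ₗ[R] Z) (hg : Function.Surjective g) : SES (LinearMap.ker g).subtype g where
  inj := Subtype.val_injective
  ex := LinearMap.exact_subtype_ker_map g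
  surj := hg

lemma ses_mkQ (A : Submodule R Y) : SES A.subtype A.mkQ where
  inj := Subtype.val_injective
  ex := LinearMap.exact_subtype_mkQ A
  surj := A.mkQ_surjective

/-- isomorphic modules have isomorphic Ext: vanishing version, second variable. -/
lemma sub_congr_right (e : X ≃ₗ[R] Y) (i : ℕ) (h : Subsingleton (EE R N X i)) :
    Subsingleton (EE R N Y i) := by
  refine ⟨fun a b => ?_⟩
  have key : ∀ a : EE R N Y i, a = 0 := fun a => by
    have : push N (e : X →ₗ[R] Y) i (push N (e.symm : Y →ₗ[R] X) i a) = a := by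
      rw [push_push]; simp [push_id]
    rw [← this, Subsingleton.elim (push N (e.symm : Y →ₗ[R] X) i a) 0, map_zero]
  rw [key a, key b]

lemma sub_congr_left (e : N ≃ₗ[R] N') (i : ℕ) (h : Subsingleton (EE R N X i)) :
    Subsingleton (EE R N' X i) := by
  refine ⟨fun a b => ?_⟩
  have key : ∀ a : EE R N' X i, a = 0 := fun a => by
    have : pull (e.symm : N' →ₗ[R] N) X i (pull (e : N →ₗ[R] N') X i a) = a := by
      rw [pull_pull]; simp [pull_id]
    rw [← this, Subsingleton.elim (pull (e : N →ₗ[R] N') X i a) 0, map_zero]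
  rw [key a, key b]

end layer

/-- comparison of the two Ext -/
lemma ext_bridge (R : Type u) [CommRing R] (M N : Type u) [AddCommGroup M] [Module R M]
    [AddCommGroup N] [Module R N] (i : ℕ) :
    Subsingleton (ExtMod R (ModuleCat.of R M) (ModuleCat.of R N) i) ↔
      Subsingleton (EE R M N i) := by
  let P := ProjectiveResolution.of (ModuleCat.of R M)
  have e := P.isoExt (R := R) i (ModuleCat.of R N)
  have h1 : Subsingleton (ExtMod R (ModuleCat.of R M) (ModuleCat.of R N) i) ↔
      (P.complex.linearYonedaObj R (ModuleCat.of R N)).ExactAt i := by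
    rw [HomologicalComplex.exactAt_iff_isZero_homology, ← e.isZero_iff]
    exact (ModuleCat.isZero_iff_subsingleton).symm
  rw [h1]
  have ho : ∀ (a b : ℕ) (f : P.complex.X b ⟶ ModuleCat.of R N),
      (P.complex.linearYonedaObj R (ModuleCat.of R N)).d b a f = P.complex.d a b ≫ f := by
    intro a b f
    rfl
  cases i with
  | zero =>
    rw [HomologicalComplex.exactAt_iff' _ 0 0 1 (by simp) (by simp),
      ShortComplex.moduleCat_exact_iff, sub0]
    constructor
    · intro h f
      let f0 : ((ChainComplex.single₀ (ModuleCat R)).obj (ModuleCat.of R M)).X 0 ⟶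
        ModuleCat.of R N := ModuleCat.ofHom f
      obtain ⟨g, hg⟩ := h (P.π.f 0 ≫ f0) (by
        refine (ho 1 0 _).trans ?_
        rw [← Category.assoc]
        have hz : P.complex.d 1 0 ≫ P.π.f 0 = 0 := P.complex_d_comp_π_f_zero
        rw [hz]
        exact Limits.zero_comp)
      have h0 : P.π.f 0 ≫ f0 = 0 := by
        rw [← hg]
        refine (ho 0 0 g).trans ?_
        rw [HomologicalComplex.shape _ _ _ (by simp)]
        exact Limits.zero_comp
      have : f0 = 0 := by
        rw [← cancel_epi (P.π.f 0), h0]; exact Limits.comp_zero.symm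
      exact congrArg ModuleCat.Hom.hom this
    · intro h f hf
      have hf' : P.complex.d 1 0 ≫ (f : P.complex.X 0 ⟶ ModuleCat.of R N) = 0 :=
        (ho 1 0 f).symm.trans hf
      have hz := h (P.exact₀.desc f hf').hom
      refine ⟨0, ?_⟩
      have : (f : P.complex.X 0 ⟶ ModuleCat.of R N) = 0 := by
        rw [← P.exact₀.g_desc f hf']
        have : P.exact₀.desc f hf' = 0 := by ext x; exact LinearMap.congr_fun hz x
        rw [this]; exact Limits.comp_zero
      rw [map_zero]; exact this.symm
  | succ j =>
    rw [HomologicalComplex.exactAt_iff' _ j (j+1) (j+2) (by simp) (by simp),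
      ShortComplex.moduleCat_exact_iff]
    constructor
    · intro h
      have key : ∀ a : EE R M N (j+1), a = 0 := fun a => by
        obtain ⟨f, hf, rfl⟩ := P.extMk_surjective a (j+2) rfl
        rw [P.extMk_eq_zero_iff f (j+2) rfl hf j rfl]
        obtain ⟨g, hg⟩ := h f ((ho _ _ f).trans hf)
        exact ⟨g, (ho _ _ g).symm.trans hg⟩
      exact ⟨fun a b => by rw [key a, key b]⟩
    · intro h f hf
      have hf' : P.complex.d (j+2) (j+1) ≫ (f : P.complex.X (j+1) ⟶ ModuleCat.of R N) = 0 :=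
        (ho _ _ f).symm.trans hf
      obtain ⟨g, hg⟩ := (P.extMk_eq_zero_iff f (j+2) rfl hf' j rfl).1 (Subsingleton.elim _ _)
      exact ⟨g, (ho _ _ g).trans hg⟩

end S3



namespace S3

section basics
variable {R : Type u} [CommRing R]
variable {N N' X Y Z M : Type u} [AddCommGroup N] [Module R N] [AddCommGroup N'] [Module R N']
  [AddCommGroup X] [Module R X] [AddCommGroup Y] [Module R Y] [AddCommGroup Z] [Module R Z]
  [AddCommGroup M] [Module R M]

lemma sub_of_zero {i : ℕ} (h : ∀ ξ : EE R N X i, ξ = 0) : Subsingleton (EE R N X i) :=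
  ⟨fun a b => by rw [h a, h b]⟩

lemma pull_add (f g : N' →ₗ[R] N) (i : ℕ) (ξ : EE R N X i) :
    pull (f + g) X i ξ = pull f X i ξ + pull g X i ξ := by
  simp [pull, ModuleCat.ofHom_add, Abelian.Ext.mk₀_add]

lemma pull_sum {ι : Type*} (s : Finset ι) (f : ι → (N' →ₗ[R] N)) (i : ℕ) (ξ : EE R N X i) :
    pull (∑ j ∈ s, f j) X i ξ = ∑ j ∈ s, pull (f j) X i ξ := by
  classical
  induction s using Finset.induction_on with
  | empty => simp [pull_zero]
  | insert a s ha ih => simp [Finset.sum_insert ha, pull_add, ih]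

section
variable {f : X →ₗ[R] Y} {g : Y →ₗ[R] Z} (h : SES f g)
include h

lemma SES.conX {i : ℕ} (h1 : Subsingleton (EE R Y N i)) (h2 : Subsingleton (EE R Z N (i + 1))) :
    Subsingleton (EE R X N i) := sub_of_zero fun ξ => by
  obtain ⟨ζ, hζ⟩ := h.con1 ξ (Subsingleton.elim _ _)
  rw [← hζ, Subsingleton.elim ζ 0, map_zero]

lemma SES.conY {i : ℕ} (h1 : Subsingleton (EE R X N i)) (h2 : Subsingleton (EE R Z N i)) :
    Subsingleton (EE R Y N i) := sub_of_zero fun ξ => by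
  obtain ⟨ζ, hζ⟩ := h.con2 ξ (Subsingleton.elim _ _)
  rw [← hζ, Subsingleton.elim ζ 0, map_zero]

lemma SES.conZ {i : ℕ} (h1 : Subsingleton (EE R X N i)) (h2 : Subsingleton (EE R Y N (i + 1))) :
    Subsingleton (EE R Z N (i + 1)) := sub_of_zero fun ξ => by
  obtain ⟨ζ, hζ⟩ := h.con3 ξ (Subsingleton.elim _ _)
  rw [← hζ, Subsingleton.elim ζ 0, map_zero]

lemma SES.pull_inj0 (ξ : EE R Z N 0) (hz : pull g N 0 ξ = 0) : ξ = 0 := by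
  obtain ⟨a, rfl⟩ := hom0_surj ξ
  rw [pull_hom0, ← hom0_zero] at hz
  have := hom0_inj hz
  rw [show a = 0 from ?_, hom0_zero]
  ext x
  obtain ⟨y, rfl⟩ := h.surj x
  simpa using LinearMap.congr_fun this y

lemma SES.conZ0 (h2 : Subsingleton (EE R Y N 0)) :
    Subsingleton (EE R Z N 0) := sub_of_zero fun ξ => h.pull_inj0 ξ (Subsingleton.elim _ _)

lemma SES.covX {i : ℕ} (h1 : Subsingleton (EE R N Z i)) (h2 : Subsingleton (EE R N Y (i + 1))) :
    Subsingleton (EE R N X (i + 1)) := sub_of_zero fun ξ => by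
  obtain ⟨ζ, hζ⟩ := h.cov1 ξ (Subsingleton.elim _ _)
  rw [← hζ, Subsingleton.elim ζ 0, map_zero]

lemma SES.covX0 (h2 : Subsingleton (EE R N Y 0)) :
    Subsingleton (EE R N X 0) := sub_of_zero fun ξ => push_inj0 f h.inj ξ (Subsingleton.elim _ _)

lemma SES.covY {i : ℕ} (h1 : Subsingleton (EE R N X i)) (h2 : Subsingleton (EE R N Z i)) :
    Subsingleton (EE R N Y i) := sub_of_zero fun ξ => by
  obtain ⟨ζ, hζ⟩ := h.cov2 ξ (Subsingleton.elim _ _)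
  rw [← hζ, Subsingleton.elim ζ 0, map_zero]

lemma SES.covZ {i : ℕ} (h1 : Subsingleton (EE R N Y i)) (h2 : Subsingleton (EE R N X (i + 1))) :
    Subsingleton (EE R N Z i) := sub_of_zero fun ξ => by
  obtain ⟨ζ, hζ⟩ := h.cov3 ξ (Subsingleton.elim _ _)
  rw [← hζ, Subsingleton.elim ζ 0, map_zero]

lemma SES.extend (h1 : Subsingleton (EE R Z N 1)) (a : X →ₗ[R] N) :
    ∃ b : Y →ₗ[R] N, b ∘ₗ f = a := by
  obtain ⟨ζ, hζ⟩ := h.con1 (hom0 a) (Subsingleton.elim _ _)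
  obtain ⟨b, rfl⟩ := hom0_surj ζ
  rw [pull_hom0] at hζ
  exact ⟨b, hom0_inj hζ⟩

/-- conversely, extendability from a projective gives vanishing of Ext¹ -/
lemma SES.ext1_of_extend (hY : Subsingleton (EE R Y N 1))
    (he : ∀ a : X →ₗ[R] N, ∃ b : Y →ₗ[R] N, b ∘ₗ f = a) : Subsingleton (EE R Z N 1) :=
  sub_of_zero fun ξ => by
  obtain ⟨ζ, hζ⟩ := h.con3 ξ (Subsingleton.elim _ _)
  obtain ⟨a, rfl⟩ := hom0_surj ζ
  obtain ⟨b, rfl⟩ := he a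
  rw [← hζ, ← pull_hom0, h.ε_pull]

lemma SES.hom (he : ∀ a : X →ₗ[R] N, ∃ b : Y →ₗ[R] N, b ∘ₗ f = a) :
    SES (LinearMap.lcomp R N g) (LinearMap.lcomp R N f) where
  inj := fun a b hab => by
    ext z
    obtain ⟨y, rfl⟩ := h.surj z
    exact LinearMap.congr_fun hab y
  surj := fun a => he a
  ex := fun a => by
    constructor
    · intro ha
      have hle : LinearMap.ker g ≤ LinearMap.ker a := fun y hy => by
        obtain ⟨x, rfl⟩ := (h.ex y).1 hy
        exact LinearMap.congr_fun ha x
      let e := g.quotKerEquivOfSurjective h.surj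
      refine ⟨(LinearMap.ker g).liftQ a hle ∘ₗ e.symm.toLinearMap, ?_⟩
      ext y
      have : e.symm (g y) = (LinearMap.ker g).mkQ y := by
        rw [LinearEquiv.symm_apply_eq]; rfl
      simp [this]
    · rintro ⟨b, rfl⟩
      ext x
      simp [h.ex.apply_apply_eq_zero]

end

lemma exists_cover (R : Type u) [CommRing R] (Y : Type u) [AddCommGroup Y] [Module R Y]
    [Module.Finite R Y] : ∃ (r : ℕ) (π : (Fin r → R) →ₗ[R] Y), Function.Surjective π :=
  Module.Finite.exists_fin' R Y

/-- vanishing on powers -/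
lemma sub_pi {r i : ℕ} (h : Subsingleton (EE R N X i)) : Subsingleton (EE R N (Fin r → X) i) :=
  sub_of_zero fun ξ => by
  have h1 : (LinearMap.id : (Fin r → X) →ₗ[R] (Fin r → X)) =
      ∑ j : Fin r, LinearMap.single R (fun _ => X) j ∘ₗ LinearMap.proj j := by
    apply LinearMap.ext; intro v
    funext k
    simp [Finset.sum_apply, Pi.single_apply]
  rw [← push_id i ξ, h1, push_sum]
  refine Finset.sum_eq_zero fun j _ => ?_
  rw [← push_push, Subsingleton.elim (push N _ i ξ) 0, map_zero]

lemma sub_pi_src {r i : ℕ} (h : Subsingleton (EE R N X i)) :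
    Subsingleton (EE R (Fin r → N) X i) :=
  sub_of_zero fun ξ => by
  have h1 : (LinearMap.id : (Fin r → N) →ₗ[R] (Fin r → N)) =
      ∑ j : Fin r, LinearMap.single R (fun _ => N) j ∘ₗ LinearMap.proj j := by
    apply LinearMap.ext; intro v
    funext k
    simp [Finset.sum_apply, Pi.single_apply]
  rw [← pull_id i ξ, h1, pull_sum]
  refine Finset.sum_eq_zero fun j _ => ?_
  rw [← pull_pull, Subsingleton.elim (pull _ X i ξ) 0, map_zero]

lemma id_homF {r : ℕ} : (LinearMap.id : ((Fin r → R) →ₗ[R] M) →ₗ[R] ((Fin r → R) →ₗ[R] M)) =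
    ∑ j : Fin r, LinearMap.smulRightₗ (LinearMap.proj j : (Fin r → R) →ₗ[R] R) ∘ₗ
      LinearMap.applyₗ (Pi.single j (1 : R)) := by
  apply LinearMap.ext; intro f
  apply LinearMap.ext; intro v
  simp only [LinearMap.id_apply, LinearMap.sum_apply, LinearMap.comp_apply,
    LinearMap.smulRightₗ_apply, LinearMap.proj_apply, LinearMap.applyₗ_apply_apply]
  conv_lhs => rw [pi_eq_sum_univ' v, map_sum]
  refine Finset.sum_congr rfl fun j _ => ?_
  rw [map_smul]
  congr 2

lemma homF_eq_zero {r i : ℕ} (ξ : EE R N ((Fin r → R) →ₗ[R] M) i)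
    (h : ∀ j, push N (LinearMap.applyₗ (Pi.single j (1 : R))) i ξ = 0) : ξ = 0 := by
  rw [← push_id i ξ, id_homF, push_sum]
  refine Finset.sum_eq_zero fun j _ => ?_
  rw [← push_push, h, map_zero]

lemma sub_homF {r i : ℕ} (h : Subsingleton (EE R N M i)) :
    Subsingleton (EE R N ((Fin r → R) →ₗ[R] M) i) :=
  sub_of_zero fun ξ => homF_eq_zero ξ fun _ => Subsingleton.elim _ _

/-- All higher Ext into the ring vanish. -/
def Van (R : Type u) [CommRing R] (Y : Type u) [AddCommGroup Y] [Module R Y] : Prop :=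
  ∀ j, Subsingleton (EE R Y R (j + 1))

lemma van_ker {F : Type u} [AddCommGroup F] [Module R F] [Module.Projective R F]
    {π : F →ₗ[R] Y} (hπ : Function.Surjective π) (h : Van R Y) : Van R (LinearMap.ker π) :=
  fun j => (ses_ker π hπ).conX (sub_proj j) (h (j + 1))

variable [IsNoetherianRing R]

lemma lemD (t : ℕ) (hN : ∀ i < t, Subsingleton (EE R N R i)) (i : ℕ) : i < t →
    ∀ (Y : Type u) [AddCommGroup Y] [Module R Y] [Module.Finite R Y], Van R Y →
      Subsingleton (EE R N (Y →ₗ[R] R) i) := by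
  induction i with
  | zero =>
    intro hi Y _ _ _ hY
    obtain ⟨r, π, hπ⟩ := exists_cover R Y
    exact ((ses_ker π hπ).hom ((ses_ker π hπ).extend (hY 0))).covX0 (sub_homF (hN 0 hi))
  | succ i ih =>
    intro hi Y _ _ _ hY
    obtain ⟨r, π, hπ⟩ := exists_cover R Y
    exact ((ses_ker π hπ).hom ((ses_ker π hπ).extend (hY 0))).covX
      (ih (by omega) _ (van_ker hπ hY)) (sub_homF (hN _ hi))

lemma kl_inj (t : ℕ) (hN : ∀ i < t, Subsingleton (EE R N R i))
    [Module.Finite R Y] (hY : Van R Y) (ξ : EE R N (Y →ₗ[R] R) t)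
    (hξ : ∀ y : Y, push N (LinearMap.applyₗ y) t ξ = 0) : ξ = 0 := by
  obtain ⟨r, π, hπ⟩ := exists_cover R Y
  have hs := (ses_ker π hπ).hom ((ses_ker π hπ).extend (hY 0))
  have h0 : push N (LinearMap.lcomp R R π) t ξ = 0 := by
    apply homF_eq_zero
    intro j
    rw [push_push]
    exact hξ (π (Pi.single j 1))
  cases t with
  | zero => exact push_inj0 _ hs.inj ξ h0
  | succ s =>
    obtain ⟨ζ, hζ⟩ := hs.cov1 ξ h0
    have := lemD (s + 1) hN s (by omega) _ (van_ker hπ hY)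
    rw [← hζ, Subsingleton.elim ζ 0, map_zero]

lemma kl_ex (t : ℕ) (hN : ∀ i < t, Subsingleton (EE R N R i))
    [Module.Finite R Y] (hY : Van R Y) (l : Y →ₗ[R] EE R N R t) :
    ∃ ξ : EE R N (Y →ₗ[R] R) t, ∀ y, push N (LinearMap.applyₗ y) t ξ = l y := by
  obtain ⟨r, π, hπ⟩ := exists_cover R Y
  have hs := (ses_ker π hπ).hom ((ses_ker π hπ).extend (hY 0))
  let ζ : EE R N ((Fin r → R) →ₗ[R] R) t :=
    ∑ j, push N (LinearMap.smulRightₗ (LinearMap.proj j : (Fin r → R) →ₗ[R] R)) t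
      (l (π (Pi.single j 1)))
  have hζ : ∀ v, push N (LinearMap.applyₗ v) t ζ = l (π v) := by
    intro v
    simp only [ζ, map_sum, push_push]
    conv_rhs => rw [pi_eq_sum_univ' v, map_sum, map_sum]
    refine Finset.sum_congr rfl fun j _ => ?_
    have : (LinearMap.applyₗ v : ((Fin r → R) →ₗ[R] R) →ₗ[R] R) ∘ₗ
        LinearMap.smulRightₗ (LinearMap.proj j : (Fin r → R) →ₗ[R] R) =
        v j • LinearMap.id := by
      ext; simp
    rw [this, push_smul, push_id, map_smul, map_smul]
  have h0 : push N (LinearMap.lcomp R R (LinearMap.ker π).subtype) t ζ = 0 := by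
    apply kl_inj t hN (van_ker hπ hY)
    intro y
    rw [push_push]
    have := hζ y
    rw [LinearMap.mem_ker.1 y.2, map_zero] at this
    exact this
  obtain ⟨ξ, hξ⟩ := hs.cov2 ζ h0
  refine ⟨ξ, fun y => ?_⟩
  obtain ⟨v, rfl⟩ := hπ y
  rw [← hζ v, ← hξ, push_push]
  rfl

lemma homDepth0 (h0 : Subsingleton (EE R N M 0))
    (L : Type u) [AddCommGroup L] [Module R L] : Subsingleton (EE R N (L →ₗ[R] M) 0) := by
  rw [sub0] at h0 ⊢
  intro f
  ext x y
  have := h0 (LinearMap.applyₗ y ∘ₗ f)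
  exact LinearMap.congr_fun this x

lemma homDepth1 (h0 : Subsingleton (EE R N M 0)) (h1 : Subsingleton (EE R N M 1))
    (L : Type u) [AddCommGroup L] [Module R L] [Module.Finite R L] :
    Subsingleton (EE R N (L →ₗ[R] M) 1) := by
  obtain ⟨r, π, hπ⟩ := exists_cover R L
  set ρ := LinearMap.lcomp R M (LinearMap.ker π).subtype with hρ
  have hs : SES (LinearMap.lcomp R M π) ρ.rangeRestrict := by
    refine ⟨fun a b hab => ?_, fun a => ?_, ρ.surjective_rangeRestrict⟩
    · ext z
      obtain ⟨y, rfl⟩ := hπ z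
      exact LinearMap.congr_fun hab y
    · have hker : ρ.rangeRestrict a = 0 ↔ LinearMap.ker π ≤ LinearMap.ker a := by
        rw [Subtype.ext_iff, LinearMap.ext_iff]
        exact ⟨fun h x hx => h ⟨x, hx⟩, fun h x => h x.2⟩
      rw [hker]
      constructor
      · intro hle
        let e := π.quotKerEquivOfSurjective hπ
        refine ⟨(LinearMap.ker π).liftQ a hle ∘ₗ e.symm.toLinearMap, ?_⟩
        apply LinearMap.ext; intro y
        have : e.symm (π y) = (LinearMap.ker π).mkQ y := by
          rw [LinearEquiv.symm_apply_eq]; rfl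
        simp [this]
      · rintro ⟨b, rfl⟩ x hx
        have hx' : π x = 0 := hx
        simp [hx']
  refine hs.covX ?_ (sub_homF h1)
  have hK := homDepth0 h0 (LinearMap.ker π)
  rw [sub0] at hK ⊢
  intro f
  have := hK ((LinearMap.range ρ).subtype ∘ₗ f)
  ext x : 2
  simpa using LinearMap.congr_fun this x

end basics
end S3



namespace S3

/-- Totally reflexive, in terms of `EE`. -/
def TR (R : Type u) [CommRing R] (X : Type u) [AddCommGroup X] [Module R X] : Prop :=
  Function.Bijective (Module.Dual.eval R X) ∧ Van R X ∧ Van R (X →ₗ[R] R)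

lemma tr_iff (R : Type u) [CommRing R] (X : Type u) [AddCommGroup X] [Module R X] :
    TotallyReflexive R X ↔ TR R X := by
  constructor
  · rintro ⟨h1, h2⟩
    exact ⟨h1, fun j => (ext_bridge R _ _ _).1 (h2 (j + 1) (by omega)).1,
      fun j => (ext_bridge R _ _ _).1 (h2 (j + 1) (by omega)).2⟩
  · rintro ⟨h1, h2, h3⟩
    refine ⟨h1, fun i hi => ?_⟩
    obtain ⟨j, rfl⟩ : ∃ j, i = j + 1 := ⟨i - 1, by omega⟩
    exact ⟨(ext_bridge R _ _ _).2 (h2 j), (ext_bridge R _ _ _).2 (h3 j)⟩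

section
variable {R : Type u} [CommRing R]
variable {N X Y Z M : Type u} [AddCommGroup N] [Module R N]
  [AddCommGroup X] [Module R X] [AddCommGroup Y] [Module R Y] [AddCommGroup Z] [Module R Z]
  [AddCommGroup M] [Module R M]

lemma tr_free [Module.Finite R X] [Module.Projective R X] : TR R X := by
  refine ⟨Module.bijective_dual_eval R X, fun j => sub_proj j, fun j => ?_⟩
  have : Module.Projective R (Module.Dual R X) := inferInstance
  exact sub_proj j

lemma push_equiv (e : X ≃ₗ[R] Y) (i : ℕ) (ξ : EE R N X i)
    (h : push N (e : X →ₗ[R] Y) i ξ = 0) : ξ = 0 := by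
  have : push N (e.symm : Y →ₗ[R] X) i (push N (e : X →ₗ[R] Y) i ξ) = ξ := by
    rw [push_push]; simp [push_id]
  rw [← this, h, map_zero]

section
variable {f : X →ₗ[R] Y} {g : Y →ₗ[R] Z} (h : SES f g)
include h

lemma SES.eval_chase (he : ∀ a : X →ₗ[R] R, ∃ b : Y →ₗ[R] R, b ∘ₗ f = a)
    (h1 : Subsingleton (EE R (X →ₗ[R] R) R 1)) (hY : Function.Bijective (Module.Dual.eval R Y)) :
    Function.Surjective (Module.Dual.eval R Z) ∧
    (Function.Surjective (Module.Dual.eval R X) → Function.Injective (Module.Dual.eval R Z)) := by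
  have hs := h.hom he
  have hs2 := hs.hom (hs.extend h1)
  have nat2 : ∀ y, Module.Dual.eval R Z (g y) =
      LinearMap.lcomp R R (LinearMap.lcomp R R g) (Module.Dual.eval R Y y) := fun y => rfl
  have nat1 : ∀ x, Module.Dual.eval R Y (f x) =
      LinearMap.lcomp R R (LinearMap.lcomp R R f) (Module.Dual.eval R X x) := fun y => rfl
  constructor
  · intro φ
    obtain ⟨ψ, hψ⟩ := hs2.surj φ
    obtain ⟨y, rfl⟩ := hY.2 ψ
    exact ⟨g y, (nat2 y).trans hψ⟩
  · intro hX
    rw [injective_iff_map_eq_zero]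
    intro z hz
    obtain ⟨y, rfl⟩ := h.surj z
    rw [nat2] at hz
    obtain ⟨w, hw⟩ := (hs2.ex _).1 hz
    obtain ⟨x, rfl⟩ := hX w
    rw [← nat1] at hw
    rw [← hY.1 hw, h.ex.apply_apply_eq_zero]

end

variable [IsNoetherianRing R]

lemma refl_ex [Module.Finite R X] (hb : Function.Bijective (Module.Dual.eval R X))
    (hv : Van R (X →ₗ[R] R)) (t : ℕ) (hN : ∀ i < t, Subsingleton (EE R N R i))
    (l : (X →ₗ[R] R) →ₗ[R] EE R N R t) :
    ∃ ξ : EE R N X t, ∀ f : X →ₗ[R] R, push N f t ξ = l f := by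
  obtain ⟨ξ, hξ⟩ := kl_ex t hN hv l
  obtain ⟨e, he⟩ : ∃ e : X ≃ₗ[R] ((X →ₗ[R] R) →ₗ[R] R), ∀ x f, e x f = f x :=
    ⟨LinearEquiv.ofBijective _ hb, fun x f => rfl⟩
  refine ⟨push N (e.symm : ((X →ₗ[R] R) →ₗ[R] R) →ₗ[R] X) t ξ, fun f => ?_⟩
  have hc : f ∘ₗ (e.symm : ((X →ₗ[R] R) →ₗ[R] R) →ₗ[R] X) = LinearMap.applyₗ f := by
    apply LinearMap.ext
    intro φ
    obtain ⟨x, rfl⟩ := e.surjective φ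
    rw [LinearMap.comp_apply, LinearEquiv.coe_coe, e.symm_apply_apply,
      LinearMap.applyₗ_apply_apply, he]
  rw [push_push, hc, hξ f]

lemma refl_inj [Module.Finite R X] (hb : Function.Bijective (Module.Dual.eval R X))
    (hv : Van R (X →ₗ[R] R)) (t : ℕ) (hN : ∀ i < t, Subsingleton (EE R N R i))
    (ξ : EE R N X t) (h : ∀ f : X →ₗ[R] R, push N f t ξ = 0) : ξ = 0 := by
  apply push_equiv (LinearEquiv.ofBijective _ hb)
  apply kl_inj t hN hv
  intro f
  rw [push_push]
  exact h f

lemma refl_D [Module.Finite R X] (hb : Function.Bijective (Module.Dual.eval R X))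
    (hv : Van R (X →ₗ[R] R)) (t : ℕ) (hN : ∀ i < t, Subsingleton (EE R N R i)) (i : ℕ)
    (hi : i < t) : Subsingleton (EE R N X i) :=
  sub_congr_right (LinearEquiv.ofBijective _ hb).symm i (lemD t hN i hi _ hv)

end

section loc
variable {R : Type u} [CommRing R] [IsLocalRing R] [IsNoetherianRing R]

lemma exists_hom_ne {Y H : Type u} [AddCommGroup Y] [Module R Y] [Module.Finite R Y]
    [AddCommGroup H] [Module R H] (I : Submodule R Y) (hI : I ≠ ⊤) (w : H) (hw : w ≠ 0)
    (hm : ∀ r ∈ IsLocalRing.maximalIdeal R, r • w = 0) :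
    ∃ l : Y →ₗ[R] H, (∀ y ∈ I, l y = 0) ∧ l ≠ 0 := by
  obtain ⟨C, hC, hIC⟩ := (eq_top_or_exists_le_coatom I).resolve_left hI
  have hs : IsSimpleModule R (Y ⧸ C) := isSimpleModule_iff_isCoatom.2 hC
  obtain ⟨J, hJ, ⟨e⟩⟩ := isSimpleModule_iff_quot_maximal.1 hs
  have hJm := IsLocalRing.eq_maximalIdeal hJ
  subst hJm
  let q : (R ⧸ IsLocalRing.maximalIdeal R) →ₗ[R] H :=
    Submodule.liftQ _ (LinearMap.toSpanSingleton R H w) (fun r hr => by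
      simpa using hm r hr)
  refine ⟨q ∘ₗ e.toLinearMap ∘ₗ C.mkQ, fun y hy => ?_, fun h0 => ?_⟩
  · have : C.mkQ y = 0 := by simpa using hIC hy
    simp only [LinearMap.comp_apply, this, map_zero]
  · obtain ⟨y, hy⟩ := C.mkQ_surjective (e.symm (Submodule.Quotient.mk 1))
    have := LinearMap.congr_fun h0 y
    simp only [LinearMap.comp_apply, hy] at this
    have hq : q (Submodule.Quotient.mk 1) = w := one_smul R w
    apply hw
    rw [← hq]
    rw [LinearEquiv.coe_coe, e.apply_symm_apply] at this
    exact this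


variable {G1 G0 X : Type u} [AddCommGroup G1] [Module R G1] [AddCommGroup G0] [Module R G0]
  [AddCommGroup X] [Module R X]

lemma ab1 {d : ℕ} (hk : ∀ i < d + 1, Subsingleton (EE R (IsLocalRing.ResidueField R) R i))
    (hkd : Nontrivial (EE R (IsLocalRing.ResidueField R) R (d + 1))) [Module.Finite R G1] [Module.Finite R G0]
    {f : G1 →ₗ[R] G0} {g : G0 →ₗ[R] X} (h : SES f g) (h1 : TR R G1) (h0 : TR R G0)
    (hX : Subsingleton (EE R (IsLocalRing.ResidueField R) X d)) : TR R X := by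
  have he : ∀ a : G1 →ₗ[R] R, ∃ b : G0 →ₗ[R] R, b ∘ₗ f = a := by
    by_contra hcon
    have hI : LinearMap.range (LinearMap.lcomp R R f) ≠ ⊤ := fun ht => hcon fun a => by
      have : a ∈ LinearMap.range (LinearMap.lcomp R R f) := by rw [ht]; trivial
      exact this
    obtain ⟨w, hw⟩ := exists_ne (0 : EE R (IsLocalRing.ResidueField R) R (d + 1))
    obtain ⟨l, hl0, hl⟩ := exists_hom_ne _ hI w hw (fun r hr =>
      smul_eq_zero_of_src r (fun x => by
        rw [Algebra.smul_def, IsLocalRing.ResidueField.algebraMap_eq,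
          (IsLocalRing.residue_eq_zero_iff r).2 hr, zero_mul]) _ w)
    obtain ⟨ξ, hξ⟩ := refl_ex h1.1 h1.2.2 (d + 1) hk l
    have hz : push (IsLocalRing.ResidueField R) f (d + 1) ξ = 0 := by
      apply refl_inj h0.1 h0.2.2 (d + 1) hk
      intro b
      rw [push_push, hξ]
      exact hl0 _ ⟨b, rfl⟩
    obtain ⟨ζ, hζ⟩ := h.cov1 ξ hz
    rw [Subsingleton.elim ζ 0, map_zero] at hζ
    apply hl
    ext b
    rw [← hξ b, ← hζ, map_zero]; rfl
  have hs := h.hom he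
  obtain ⟨e1, e2⟩ := h.eval_chase he (h1.2.2 0) h0.1
  refine ⟨⟨e2 h1.1.2, e1⟩, fun j => ?_, fun j => hs.conX (h0.2.2 j) (h1.2.2 (j + 1))⟩
  cases j with
  | zero => exact h.ext1_of_extend (h0.2.1 0) he
  | succ j => exact h.conZ (h1.2.1 j) (h0.2.1 (j + 1))

lemma ab {d : ℕ} (hk : ∀ i < d + 1, Subsingleton (EE R (IsLocalRing.ResidueField R) R i))
    (hkd : Nontrivial (EE R (IsLocalRing.ResidueField R) R (d + 1))) (n : ℕ) : ∀ (X : ModuleCat.{u} R), Module.Finite R X →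
      GdimLE R n X → (∀ i < d + 1, Subsingleton (EE R (IsLocalRing.ResidueField R) X i)) → TR R X := by
  induction n with
  | zero => intro X _ hX _; exact (tr_iff R X).1 hX
  | succ n ih =>
    rintro X hf ⟨G, g, hGf, hG, hg, hker⟩ hX
    have h0 := (tr_iff R G).1 hG
    have h := ses_ker g hg
    have hGd : ∀ i < d + 1, Subsingleton (EE R (IsLocalRing.ResidueField R) G i) := fun i hi =>
      refl_D h0.1 h0.2.2 (d + 1) hk i hi
    have h1 : TR R (LinearMap.ker g) := by
      refine ih (ModuleCat.of R (LinearMap.ker g)) inferInstance hker ?_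
      intro i hi
      cases i with
      | zero => exact h.covX0 (hGd 0 hi)
      | succ i => exact h.covX (hX i (by omega)) (hGd _ hi)
    exact ab1 hk hkd h h1 h0 (hX d (by omega))

lemma climb {d : ℕ} (hd : 1 ≤ d) (hk : ∀ i < d + 1, Subsingleton (EE R (IsLocalRing.ResidueField R) R i)) (s : ℕ) :
    ∀ (L : Type u) [AddCommGroup L] [Module R L] [Module.Finite R L],
      (∀ i < s, Subsingleton (EE R L R (i + 1))) →
      ∀ i < s + 2, i < d + 1 → Subsingleton (EE R (IsLocalRing.ResidueField R) (L →ₗ[R] R) i) := by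
  induction s with
  | zero =>
    intro L _ _ _ _ i hi _
    interval_cases i
    · exact homDepth0 (hk 0 (by omega)) L
    · exact homDepth1 (hk 0 (by omega)) (hk 1 (by omega)) L
  | succ s ih =>
    intro L _ _ _ hL i hi hid
    obtain ⟨r, π, hπ⟩ := exists_cover R L
    have hs := (ses_ker π hπ).hom ((ses_ker π hπ).extend (hL 0 (by omega)))
    cases i with
    | zero => exact hs.covX0 (sub_homF (hk 0 hid))
    | succ i =>
      refine hs.covX (ih _ ?_ i (by omega) (by omega)) (sub_homF (hk _ hid))
      intro j hj
      exact (ses_ker π hπ).conX (sub_proj j) (hL (j + 1) (by omega))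

lemma step1 {d : ℕ} (hd : 1 ≤ d) (hk : ∀ i < d + 1, Subsingleton (EE R (IsLocalRing.ResidueField R) R i))
    (hkd : Nontrivial (EE R (IsLocalRing.ResidueField R) R (d + 1))) (M : Type u) [AddCommGroup M] [Module R M]
    [Module.Finite R M] (hG : FiniteGdim R (M →ₗ[R] R))
    (hM : ∀ i < d + 1, Subsingleton (EE R M R (i + 1))) : TR R M := by
  obtain ⟨n, hn⟩ := hG
  have m0 : TR R (M →ₗ[R] R) := ab hk hkd n (ModuleCat.of R (M →ₗ[R] R)) inferInstance hn
    fun i hi => climb hd hk d M (fun i hi => hM i (by omega)) i (by omega) hi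
  obtain ⟨r, π, hπ⟩ := exists_cover R M
  have s0 := ses_ker π hπ
  have e0 := s0.extend (hM 0 (by omega))
  have hM1 : ∀ i < d, Subsingleton (EE R (LinearMap.ker π) R (i + 1)) := fun i hi =>
    s0.conX (sub_proj i) (hM (i + 1) (by omega))
  have m1 : TR R ((LinearMap.ker π) →ₗ[R] R) := ab1 hk hkd (s0.hom e0) m0 tr_free
    (climb hd hk d _ hM1 d (by omega) (by omega))
  obtain ⟨r', π', hπ'⟩ := exists_cover R (LinearMap.ker π)
  have s1 := ses_ker π' hπ'
  have e1 := s1.extend (hM1 0 (by omega))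
  have hM2 : ∀ i < d - 1, Subsingleton (EE R (LinearMap.ker π') R (i + 1)) := fun i hi =>
    s1.conX (sub_proj i) (hM1 (i + 1) (by omega))
  have m2 : TR R ((LinearMap.ker π') →ₗ[R] R) := ab1 hk hkd (s1.hom e1) m1 tr_free
    (climb hd hk (d - 1) _ hM2 d (by omega) (by omega))
  have c1 := (s1.eval_chase e1 (m2.2.1 0) (tr_free).1).1
  have c0 := s0.eval_chase e0 (m1.2.1 0) (tr_free).1
  have hb : Function.Bijective (Module.Dual.eval R M) := ⟨c0.2 c1, c0.1⟩
  exact ⟨hb, fun j => sub_congr_left (LinearEquiv.ofBijective _ hb).symm _ (m0.2.2 j), m0.2.1⟩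

end loc
end S3



namespace S3

section fac
variable {R : Type u} [CommRing R]

/-- multiplication by `r` on `L` factors through a finite free module -/
def Fac (r : R) (L : Type u) [AddCommGroup L] [Module R L] : Prop :=
  ∃ (m : ℕ) (a : L →ₗ[R] (Fin m → R)) (b : (Fin m → R) →ₗ[R] L), b ∘ₗ a = r • LinearMap.id

variable {L F : Type u} [AddCommGroup L] [Module R L] [AddCommGroup F] [Module R F]

lemma Fac.section {r : R} (h : Fac r L) (π : F →ₗ[R] L) (hπ : Function.Surjective π) :
    ∃ σ : L →ₗ[R] F, π ∘ₗ σ = r • LinearMap.id := by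
  obtain ⟨m, a, b, hab⟩ := h
  obtain ⟨c, hc⟩ := Module.projective_lifting_property π b hπ
  exact ⟨c ∘ₗ a, by rw [← LinearMap.comp_assoc, hc, hab]⟩

lemma Fac.ker {r : R} (h : Fac r L) {m : ℕ} (π : (Fin m → R) →ₗ[R] L)
    (hπ : Function.Surjective π) : Fac r (LinearMap.ker π) := by
  obtain ⟨σ, hσ⟩ := h.section π hπ
  have hs : ∀ x, π (σ x) = r • x := fun x => LinearMap.congr_fun hσ x
  refine ⟨m, (LinearMap.ker π).subtype,
    LinearMap.codRestrict _ (r • LinearMap.id - σ ∘ₗ π) (fun v => ?_), ?_⟩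
  · simp [hs]
  · ext v : 2
    simp

lemma Fac.add {r s : R} [Module.Finite R L] (h : Fac r L) (h' : Fac s L) : Fac (r + s) L := by
  obtain ⟨m, π, hπ⟩ := exists_cover R L
  obtain ⟨a, ha⟩ := h.section π hπ
  obtain ⟨b, hb⟩ := h'.section π hπ
  exact ⟨m, a + b, π, by rw [LinearMap.comp_add, ha, hb, add_smul]⟩

lemma Fac.smul {r : R} (s : R) (h : Fac r L) : Fac (s * r) L := by
  obtain ⟨m, a, b, hab⟩ := h
  exact ⟨m, a, s • b, by rw [LinearMap.smul_comp, hab, mul_smul]⟩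

/-- the ideal of elements factoring -/
def facIdeal (R : Type u) [CommRing R] (L : Type u) [AddCommGroup L] [Module R L]
    [Module.Finite R L] : Ideal R where
  carrier := {r | Fac r L}
  add_mem' h h' := Fac.add h h'
  zero_mem' := ⟨0, 0, 0, by simp⟩
  smul_mem' s _ h := Fac.smul s h

lemma mem_facIdeal [Module.Finite R L] {r : R} : r ∈ facIdeal R L ↔ Fac r L := Iff.rfl

/-- projective dimension at most `m`, by Ext -/
def PD (R : Type u) [CommRing R] (m : ℕ) (L : Type u) [AddCommGroup L] [Module R L] : Prop :=
  ∀ (X : Type u) [AddCommGroup X] [Module R X] (i : ℕ), Subsingleton (EE R L X (m + i + 1))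

lemma pd_of_pdle (m : ℕ) : ∀ (X : ModuleCat.{u} R), PdLE R m X → PD R m X := by
  induction m with
  | zero =>
    intro X hX Y _ _ i
    have : Module.Projective R X := hX
    exact sub_proj _
  | succ m ih =>
    rintro X ⟨G, g, hG, hg, hk⟩ Y _ _ i
    have := ih _ hk Y i
    have h := (ses_ker g hg).conZ this (sub_proj _)
    rw [show m + 1 + i = m + i + 1 by ring]
    exact h

end fac

section loc
variable {R : Type u} [CommRing R] [IsNoetherianRing R]

lemma ses_loc {X Y Z : Type u} [AddCommGroup X] [Module R X] [AddCommGroup Y] [Module R Y]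
    [AddCommGroup Z] [Module R Z] (S : Submonoid R)
    {f : X →ₗ[R] Y} {g : Y →ₗ[R] Z} (h : SES f g) :
    SES (LocalizedModule.map S f) (LocalizedModule.map S g) where
  inj := IsLocalizedModule.map_injective S (LocalizedModule.mkLinearMap S X)
    (LocalizedModule.mkLinearMap S Y) f h.inj
  surj := LocalizedModule.map_surjective S g h.surj
  ex := LocalizedModule.map_exact S f g h.ex

lemma step2 (q : Ideal R) [q.IsPrime] (m : ℕ) : ∀ (L : Type u) [AddCommGroup L] [Module R L]
    [Module.Finite R L], Van R L →
      PD (Localization.AtPrime q) m (LocalizedModule q.primeCompl L) → ∃ s ∉ q, Fac s L := by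
  set S := q.primeCompl with hS
  induction m with
  | zero =>
    intro L _ _ _ hv hp
    obtain ⟨r, π, hπ⟩ := exists_cover R L
    have hs := ses_loc S (ses_ker π hπ)
    have := hp (LocalizedModule S (LinearMap.ker π)) 0
    obtain ⟨ζ, hζ⟩ := hs.cov3 (hom0 LinearMap.id) (Subsingleton.elim _ _)
    obtain ⟨σ, rfl⟩ := hom0_surj ζ
    rw [push_hom0] at hζ
    have hσ := hom0_inj hζ
    have hfp : Module.FinitePresentation R L := Module.finitePresentation_of_finite R L
    obtain ⟨h, s, hh⟩ := Module.FinitePresentation.exists_lift_of_isLocalizedModule S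
      (LocalizedModule.mkLinearMap S (Fin r → R))
      (σ.restrictScalars R ∘ₗ LocalizedModule.mkLinearMap S L)
    have key : LocalizedModule.mkLinearMap S L ∘ₗ (π ∘ₗ h) =
        LocalizedModule.mkLinearMap S L ∘ₗ (s • LinearMap.id) := by
      ext x
      have h1 : LocalizedModule.mkLinearMap S L (π (h x)) =
        LocalizedModule.map S π (LocalizedModule.mkLinearMap S _ (h x)) :=
        (IsLocalizedModule.map_apply S (LocalizedModule.mkLinearMap S (Fin r → R))
          (LocalizedModule.mkLinearMap S L) π (h x)).symm
      have h2 := LinearMap.congr_fun hh x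
      have h3 := LinearMap.congr_fun hσ (LocalizedModule.mkLinearMap S L x)
      simp only [LinearMap.comp_apply] at h2 ⊢
      rw [h1, h2]
      simp only [LinearMap.smul_apply, LinearMap.comp_apply, LinearMap.restrictScalars_apply,
        LinearMap.id_apply, Submonoid.smul_def] at h3 ⊢
      rw [LinearMap.map_smul_of_tower, h3, LinearMap.map_smul]
    obtain ⟨t, ht⟩ := Module.Finite.exists_smul_of_comp_eq_of_isLocalizedModule S
      (LocalizedModule.mkLinearMap S L) _ _ key
    refine ⟨(t : R) * s, (t * s).2, r, h, (t : R) • π, ?_⟩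
    rw [mul_smul, LinearMap.smul_comp]
    exact ht
  | succ m ih =>
    intro L _ _ _ hv hp
    obtain ⟨r, π, hπ⟩ := exists_cover R L
    have hs0 := ses_ker π hπ
    have hs := ses_loc S hs0
    have hpr : Module.Projective (Localization S) (LocalizedModule S (Fin r → R)) :=
      Module.projective_of_isLocalizedModule S (LocalizedModule.mkLinearMap S (Fin r → R))
    obtain ⟨s, hsq, k, a, b, hab⟩ := ih (LinearMap.ker π) (van_ker hπ hv) (fun X _ _ i => by
      refine hs.conX (sub_proj (m + i)) ?_
      have := hp X i
      rwa [show m + 1 + i = m + i + 1 by ring] at this)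
    have : ∃ a' : (Fin r → R) →ₗ[R] (Fin k → R), a' ∘ₗ (LinearMap.ker π).subtype = a := by
      have h1 : Subsingleton (EE R L (Fin k → R) 1) := sub_pi (hv 0)
      exact hs0.extend h1 a
    obtain ⟨a', ha'⟩ := this
    let c : (Fin r → R) →ₗ[R] (Fin r → R) :=
      s • LinearMap.id - (LinearMap.ker π).subtype ∘ₗ b ∘ₗ a'
    have hc : LinearMap.ker π ≤ LinearMap.ker c := fun v hv => by
      have h1 : a' v = a ⟨v, hv⟩ := LinearMap.congr_fun ha' ⟨v, hv⟩
      have h2 : b (a ⟨v, hv⟩) = s • ⟨v, hv⟩ := LinearMap.congr_fun hab ⟨v, hv⟩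
      simp [c, h1, h2]
    let e := π.quotKerEquivOfSurjective hπ
    refine ⟨s, hsq, r, (LinearMap.ker π).liftQ c hc ∘ₗ e.symm.toLinearMap, π, ?_⟩
    apply LinearMap.ext; intro x
    obtain ⟨v, rfl⟩ := hπ x
    have : e.symm (π v) = (LinearMap.ker π).mkQ v := by
      rw [LinearEquiv.symm_apply_eq]; rfl
    simp [this, c]

end loc
end S3



namespace S3

section filt
variable {R : Type u} [CommRing R] [IsNoetherianRing R]

lemma filt (i : ℕ) (X : Type u) [AddCommGroup X] [Module R X] (N : Type u) [AddCommGroup N]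
    [Module R N] [Module.Finite R N]
    (h : ∀ p : PrimeSpectrum R, Module.annihilator R N ≤ p.asIdeal →
      Subsingleton (EE R (R ⧸ p.asIdeal) X i)) : Subsingleton (EE R N X i) := by
  revert h
  induction ‹Module.Finite R N› using
    IsNoetherianRing.induction_on_isQuotientEquivQuotientPrime R with
  | subsingleton N =>
    intro _
    refine sub_of_zero fun ξ => ?_
    have := smul_eq_zero_of_src (1 : R) (fun n : N => Subsingleton.elim _ _) i ξ
    simpa using this
  | quotient N p f =>
    intro h
    refine sub_congr_left f.symm i (h p fun r hr => ?_)
    rw [Module.mem_annihilator] at hr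
    have h1 := hr (f.symm 1)
    rw [← map_smul, LinearEquiv.map_eq_zero_iff] at h1
    rw [← Ideal.Quotient.eq_zero_iff_mem]
    simpa [Algebra.smul_def] using h1
  | exact N₁ N₂ N₃ f g hf hg hfg h₁ h₃ =>
    intro h
    have hs : SES f g := ⟨hf, hfg, hg⟩
    exact hs.conY (h₁ fun p hp => h p ((LinearMap.annihilator_le_of_injective f hf).trans hp))
      (h₃ fun p hp => h p ((LinearMap.annihilator_le_of_surjective g hg).trans hp))

/-- modules killed by a power of `A` -/
def Tors (A : Ideal R) (N : Type u) [AddCommGroup N] [Module R N] : Prop :=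
  ∃ k : ℕ, ∀ r ∈ A ^ k, ∀ x : N, r • x = 0

lemma filt_tors (A : Ideal R) (i : ℕ) (X : Type u) [AddCommGroup X] [Module R X] (N : Type u)
    [AddCommGroup N] [Module R N] [Module.Finite R N] (hN : Tors A N)
    (h : ∀ p : PrimeSpectrum R, A ≤ p.asIdeal →
      Subsingleton (EE R (R ⧸ p.asIdeal) X i)) : Subsingleton (EE R N X i) := by
  refine filt i X N fun p hp => h p ?_
  obtain ⟨k, hk⟩ := hN
  have : A ^ k ≤ p.asIdeal := fun r hr => hp (Module.mem_annihilator.2 (hk r hr))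
  exact Ideal.IsPrime.le_of_pow_le this

end filt

section isch
variable {R : Type u} [CommRing R] [IsLocalRing R] [IsNoetherianRing R]

lemma isch {d : ℕ} (hk : ∀ i < d, Subsingleton (EE R (IsLocalRing.ResidueField R) R i)) (e : ℕ) :
    ∀ q : PrimeSpectrum R, Order.coheight q ≤ e → ∀ i, i + e < d →
      Subsingleton (EE R (R ⧸ q.asIdeal) R i) := by
  induction e with
  | zero =>
    intro q hq i hi
    have hm : IsMax q := by
      rw [← Order.coheight_eq_zero]; simpa using hq
    have : q.asIdeal = IsLocalRing.maximalIdeal R := by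
      have h1 : q ≤ IsLocalRing.closedPoint R := IsLocalRing.le_maximalIdeal q.2.ne_top
      have h2 := hm h1
      exact le_antisymm h1 h2
    rw [this]
    exact hk i hi
  | succ e ih =>
    intro q hq i hi
    by_cases hqm : q.asIdeal = IsLocalRing.maximalIdeal R
    · rw [hqm]; exact hk i (by omega)
    obtain ⟨r, hrm, hrq⟩ : ∃ r ∈ IsLocalRing.maximalIdeal R, r ∉ q.asIdeal := by
      by_contra hcon
      push Not at hcon
      exact hqm (le_antisymm (IsLocalRing.le_maximalIdeal q.2.ne_top) hcon)
    let f : (R ⧸ q.asIdeal) →ₗ[R] (R ⧸ q.asIdeal) := r • LinearMap.id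
    have hf : Function.Injective f := by
      rw [injective_iff_map_eq_zero]
      intro x hx
      have h1 : (Ideal.Quotient.mk q.asIdeal r) * x = 0 := by
        simpa [f, Algebra.smul_def] using hx
      rcases mul_eq_zero.1 h1 with h2 | h2
      · exact absurd (Ideal.Quotient.eq_zero_iff_mem.1 h2) hrq
      · exact h2
    have hs : SES f (LinearMap.range f).mkQ :=
      ⟨hf, LinearMap.exact_map_mkQ_range f, Submodule.mkQ_surjective _⟩
    have hC : Subsingleton (EE R ((R ⧸ q.asIdeal) ⧸ LinearMap.range f) R (i + 1)) := by
      refine filt _ _ _ fun p hp => ih p ?_ (i + 1) (by omega)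
      have hlt : q < p := by
        refine lt_of_le_of_ne (fun s hs => hp ?_) ?_
        · rw [Module.mem_annihilator]
          intro x
          obtain ⟨y, rfl⟩ := Submodule.mkQ_surjective _ x
          have : s • y = 0 := by
            rw [Algebra.smul_def, Ideal.Quotient.algebraMap_eq,
              Ideal.Quotient.eq_zero_iff_mem.2 hs, zero_mul]
          rw [← map_smul, this, map_zero]
        · rintro rfl
          apply hrq
          apply hp
          rw [Module.mem_annihilator]
          intro x
          obtain ⟨y, rfl⟩ := Submodule.mkQ_surjective _ x
          rw [← map_smul]
          simp only [Submodule.mkQ_apply, Submodule.Quotient.mk_eq_zero]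
          exact ⟨y, rfl⟩
      have h1 := Order.coheight_add_one_le hlt
      have h2 := h1.trans hq
      rw [Nat.cast_add, Nat.cast_one] at h2
      exact (ENat.add_le_add_iff_right (by simp)).1 h2
    have hsurj : ∀ ξ : EE R (R ⧸ q.asIdeal) R i, ∃ ζ, r • ζ = ξ := fun ξ => by
      obtain ⟨ζ, hζ⟩ := hs.con1 ξ (Subsingleton.elim _ _)
      refine ⟨ζ, ?_⟩
      rw [← hζ]
      change _ = pull (r • LinearMap.id) R i ζ
      rw [pull_smul, pull_id]
    have hfin : Module.Finite R (EE R (R ⧸ q.asIdeal) R i) := 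
      ModuleCat.finite_ext R (ModuleCat.of R (R ⧸ q.asIdeal)) (ModuleCat.of R R) i
    have := Submodule.eq_bot_of_le_smul_of_le_jacobson_bot (IsLocalRing.maximalIdeal R)
      (⊤ : Submodule R (EE R (R ⧸ q.asIdeal) R i)) hfin.fg_top (fun ξ _ => by
        obtain ⟨ζ, rfl⟩ := hsurj ξ
        exact Submodule.smul_mem_smul hrm trivial) (IsLocalRing.jacobson_eq_maximalIdeal ⊥
          (bot_ne_top)).ge
    refine sub_of_zero fun ξ => ?_
    have h1 : ξ ∈ (⊤ : Submodule R (EE R (R ⧸ q.asIdeal) R i)) := trivial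
    rw [this] at h1
    exact h1

lemma isch_ht {d n : ℕ} (hk : ∀ i < d, Subsingleton (EE R (IsLocalRing.ResidueField R) R i)) (hdim : ringKrullDim R = d)
    (q : PrimeSpectrum R) (hq : ¬ Order.height q ≤ n) (i : ℕ) (hi : i ≤ n) :
    Subsingleton (EE R (R ⧸ q.asIdeal) R i) := by
  have h1 : ((Order.height q + Order.coheight q : ℕ∞) : WithBot ℕ∞) ≤ d := by
    rw [← hdim, ringKrullDim, Order.krullDim_eq_iSup_height_add_coheight_of_nonempty]
    exact WithBot.coe_le_coe.2 (le_iSup (fun a => Order.height a + Order.coheight a) q)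
  have h2 : Order.height q + Order.coheight q ≤ (d : ℕ∞) := by exact_mod_cast h1
  push Not at hq
  have hc : Order.coheight q ≠ ⊤ := by
    intro h; rw [h] at h2; simp at h2
  have hh : Order.height q ≠ ⊤ := by
    intro h; rw [h] at h2; simp at h2
  obtain ⟨c, hc'⟩ := ENat.ne_top_iff_exists.1 hc
  obtain ⟨a, ha'⟩ := ENat.ne_top_iff_exists.1 hh
  rw [← hc', ← ha'] at h2
  rw [← ha'] at hq
  norm_cast at h2 hq
  exact isch hk c q hc'.ge i (by omega)

end isch
end S3



namespace S3
set_option linter.unusedSectionVars false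

section eff
variable {R : Type u} [CommRing R] [IsNoetherianRing R] (A : Ideal R)

lemma pull_of_mem {N N' X : Type u} [AddCommGroup N] [Module R N] [AddCommGroup N'] [Module R N']
    [AddCommGroup X] [Module R X] {i : ℕ} (Q : Submodule R N) (ξ : EE R N X i)
    (h : pull Q.subtype X i ξ = 0) (a : N' →ₗ[R] N) (ha : ∀ x, a x ∈ Q) : pull a X i ξ = 0 := by
  have : a = Q.subtype ∘ₗ LinearMap.codRestrict Q a ha := rfl
  rw [this, ← pull_pull, h, map_zero]

lemma ar_step {X Y Z X' Y' Z' N : Type u} [AddCommGroup X] [Module R X] [AddCommGroup Y]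
    [Module R Y] [AddCommGroup Z] [Module R Z] [AddCommGroup X'] [Module R X'] [AddCommGroup Y']
    [Module R Y'] [AddCommGroup Z'] [Module R Z'] [AddCommGroup N] [Module R N]
    {f : X →ₗ[R] Y} {g : Y →ₗ[R] Z} (h : SES f g)
    {f' : X' →ₗ[R] Y'} {g' : Y' →ₗ[R] Z'} (h' : SES f' g')
    (a : X' →ₗ[R] X) (b : Y' →ₗ[R] Y) (c : Z' →ₗ[R] Z)
    (h1 : f ∘ₗ a = b ∘ₗ f') (h2 : g ∘ₗ b = c ∘ₗ g') {i : ℕ} (ξ : EE R X N i)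
    (Q : Submodule R X) (hQ : pull Q.subtype N i ξ = 0) (ha : ∀ x, a x ∈ Q) :
    pull c N (i + 1) (h.ε N i ξ) = 0 := by
  rw [h.pull_ε_nat h' a b c h1 h2 ξ, pull_of_mem Q ξ hQ a ha, map_zero]

/-- the submodule `A ^ k • N` -/
def AP (k : ℕ) (N : Type u) [AddCommGroup N] [Module R N] : Submodule R N := A ^ k • ⊤

lemma AP_sub {k : ℕ} {F : Type u} [AddCommGroup F] [Module R F] (P : Submodule R F) (x : P)
    (h : x.1 ∈ A ^ k • P) : x ∈ AP A k P := by
  have h2 : (AP A k P).map P.subtype = A ^ k • P := by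
    rw [AP, Submodule.map_smul'', Submodule.map_top, Submodule.range_subtype]
  rw [← h2] at h
  obtain ⟨y, hy, hyx⟩ := h
  have : y = x := Subtype.ext hyx
  exact this ▸ hy

lemma ar_restrict (E : Type u) [AddCommGroup E] [Module R E] (hE : Tors A E) (i : ℕ) :
    ∀ (N : Type u) [AddCommGroup N] [Module R N] [Module.Finite R N] (ξ : EE R N E i),
      ∃ k : ℕ, pull (AP A k N).subtype E i ξ = 0 := by
  induction i with
  | zero =>
    intro N _ _ _ ξ
    obtain ⟨k, hk⟩ := hE
    obtain ⟨f, rfl⟩ := hom0_surj ξ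
    refine ⟨k, ?_⟩
    rw [pull_hom0, ← hom0_zero]
    congr 1
    ext ⟨x, hx⟩
    have hle : A ^ k • (⊤ : Submodule R N) ≤ LinearMap.ker f := by
      rw [Submodule.smul_le]
      intro r hr n _
      rw [LinearMap.mem_ker, map_smul, hk r hr]
    exact hle hx
  | succ i ih =>
    intro N _ _ _ ξ
    obtain ⟨r, π, hπ⟩ := exists_cover R N
    have hs := ses_ker π hπ
    have hpr := sub_proj (R := R) (N := Fin r → R) (X := E) i
    obtain ⟨η, rfl⟩ := hs.con3 ξ (Subsingleton.elim _ _)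
    obtain ⟨k, hk⟩ := ih (LinearMap.ker π) η
    obtain ⟨c0, hc0⟩ := Ideal.exists_pow_inf_eq_pow_smul A (LinearMap.ker π)
    have hAR : (AP A (k + c0) (Fin r → R)) ⊓ LinearMap.ker π ≤
        A ^ k • LinearMap.ker π := by
      rw [AP, hc0 (k + c0) (by omega), Nat.add_sub_cancel]
      exact Submodule.smul_mono le_rfl inf_le_right
    refine ⟨k + c0, ?_⟩
    have hmap : (AP A (k + c0) (Fin r → R)).map π =
        AP A (k + c0) N := by
      rw [AP, AP, Submodule.map_smul'', Submodule.map_top, LinearMap.range_eq_top.2 hπ]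
    obtain ⟨π', hπv⟩ : ∃ π' : (AP A (k + c0) (Fin r → R)) →ₗ[R]
        (AP A (k + c0) N), ∀ x, (π' x).1 = π x.1 :=
      ⟨π.restrict (fun x hx => hmap ▸ Submodule.mem_map_of_mem hx), fun x => rfl⟩
    have hπ' : Function.Surjective π' := by
      rintro ⟨y, hy⟩
      have hy' := hy
      rw [← hmap] at hy'
      obtain ⟨x, hx, hxy⟩ := hy'
      exact ⟨⟨x, hx⟩, Subtype.ext ((hπv _).trans hxy)⟩
    have hmem : ∀ x : LinearMap.ker π', (x.1.1 : Fin r → R) ∈ LinearMap.ker π := fun x => by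
      have h1 : π' x.1 = 0 := x.2
      rw [LinearMap.mem_ker, ← hπv, h1]; rfl
    obtain ⟨a, hav⟩ : ∃ a : LinearMap.ker π' →ₗ[R] LinearMap.ker π, ∀ x, (a x).1 = x.1.1 :=
      ⟨LinearMap.codRestrict _ (Submodule.subtype _ ∘ₗ Submodule.subtype _) hmem, fun x => rfl⟩
    have ha : ∀ x, a x ∈ AP A k (LinearMap.ker π) := fun x => by
      apply AP_sub
      rw [hav]
      exact hAR ⟨x.1.2, hmem x⟩
    have hs' := ses_ker π' hπ'
    exact ar_step hs hs' a (Submodule.subtype _) (Submodule.subtype _)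
      (LinearMap.ext hav) (LinearMap.ext fun x => (hπv x).symm) η _ hk ha

/-- effaceability of Ext classes on torsion modules -/
def Eff (s : ℕ) (X : Type u) [AddCommGroup X] [Module R X] : Prop :=
  ∀ (N : Type u) [AddCommGroup N] [Module R N] [Module.Finite R N], Tors A N →
    ∀ ξ : EE R N X s, ∃ (N' : Type u) (_ : AddCommGroup N') (_ : Module R N')
      (_ : Module.Finite R N') (k : N' →ₗ[R] N), Tors A N' ∧ Function.Surjective k ∧
        pull k X s ξ = 0

variable {A}

lemma eff_tors (E : Type u) [AddCommGroup E] [Module R E] (hE : Tors A E) (s : ℕ) :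
    Eff A (s + 1) E := by
  intro N _ _ _ hN ξ
  obtain ⟨r, π, hπ⟩ := exists_cover R N
  have hs := ses_ker π hπ
  have hpr := sub_proj (R := R) (N := Fin r → R) (X := E) s
  obtain ⟨η, rfl⟩ := hs.con3 ξ (Subsingleton.elim _ _)
  obtain ⟨k, hk⟩ := ar_restrict A E hE s (LinearMap.ker π) η
  let Q : Submodule R (Fin r → R) := A ^ k • LinearMap.ker π
  have hQ : Q ≤ LinearMap.ker π := Submodule.smul_le_right
  refine ⟨(Fin r → R) ⧸ Q, inferInstance, inferInstance, inferInstance, Q.liftQ π hQ, ?_, ?_, ?_⟩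
  · obtain ⟨j, hj⟩ := hN
    refine ⟨k + j, fun a ha x => ?_⟩
    obtain ⟨x, rfl⟩ := Q.mkQ_surjective x
    rw [← map_smul]
    simp only [Submodule.mkQ_apply, Submodule.Quotient.mk_eq_zero]
    have h1 : (A ^ j • ⊤ : Submodule R (Fin r → R)) ≤ LinearMap.ker π := by
      rw [Submodule.smul_le]
      intro b hb y _
      rw [LinearMap.mem_ker, map_smul, hj b hb]
    have h2 : (A ^ (k + j) • ⊤ : Submodule R (Fin r → R)) ≤ Q := by
      rw [pow_add, Submodule.mul_smul]
      exact Submodule.smul_mono le_rfl h1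
    exact h2 (Submodule.smul_mem_smul ha trivial)
  · intro y
    obtain ⟨x, rfl⟩ := hπ y
    exact ⟨Q.mkQ x, by simp⟩
  · have hs' := ses_mkQ Q
    rw [hs.pull_ε_nat hs' (Submodule.inclusion hQ) LinearMap.id (Q.liftQ π hQ) rfl (by ext; simp) η]
    have ha : ∀ x : Q, Submodule.inclusion hQ x ∈ AP A k (LinearMap.ker π) := fun x =>
      AP_sub _ _ _ x.2
    have h0 : pull (Submodule.inclusion hQ) E s η = 0 :=
      pull_of_mem (AP A k (LinearMap.ker π)) η hk _ ha
    rw [h0, map_zero]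

lemma eff_of_sub {X : Type u} [AddCommGroup X] [Module R X] {s : ℕ}
    (h : ∀ (N : Type u) [AddCommGroup N] [Module R N] [Module.Finite R N], Tors A N →
      Subsingleton (EE R N X s)) : Eff A s X := fun N _ _ hf hN ξ =>
  ⟨N, _, _, hf, LinearMap.id, hN, fun x => ⟨x, rfl⟩, by
    have := h N hN
    exact Subsingleton.elim _ _⟩

lemma eff_ses {X Y Z : Type u} [AddCommGroup X] [Module R X] [AddCommGroup Y] [Module R Y]
    [AddCommGroup Z] [Module R Z] {f : X →ₗ[R] Y} {g : Y →ₗ[R] Z} (h : SES f g) {s : ℕ}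
    (hY : Eff A (s + 1) Y) (hZ : Eff A s Z) : Eff A (s + 1) X := by
  intro N _ _ _ hN ξ
  obtain ⟨N', _, _, _, k, hN', hk, h0⟩ := hY N hN (push N f _ ξ)
  rw [pull_push] at h0
  obtain ⟨ζ, hζ⟩ := h.cov1 _ h0
  obtain ⟨N'', _, _, hf, k', hN'', hk', h0'⟩ := hZ N' hN' ζ
  refine ⟨N'', _, _, hf, k ∘ₗ k', hN'', hk.comp hk', ?_⟩
  rw [← pull_pull, ← hζ, h.pull_δ, h0', map_zero]

lemma ses_B {L M : Type u} [AddCommGroup L] [Module R L] [AddCommGroup M] [Module R M] {m : ℕ}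
    (π : (Fin m → R) →ₗ[R] L) (hπ : Function.Surjective π) :
    SES (LinearMap.lcomp R M π) (LinearMap.lcomp R M (LinearMap.ker π).subtype).rangeRestrict := by
  set ρ := LinearMap.lcomp R M (LinearMap.ker π).subtype with hρ
  refine ⟨fun a b hab => ?_, fun a => ?_, ρ.surjective_rangeRestrict⟩
  · ext z
    obtain ⟨y, rfl⟩ := hπ z
    exact LinearMap.congr_fun hab y
  · have hker : ρ.rangeRestrict a = 0 ↔ LinearMap.ker π ≤ LinearMap.ker a := by
      rw [Subtype.ext_iff, LinearMap.ext_iff]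
      exact ⟨fun h x hx => h ⟨x, hx⟩, fun h x => h x.2⟩
    rw [hker]
    constructor
    · intro hle
      let e := π.quotKerEquivOfSurjective hπ
      refine ⟨(LinearMap.ker π).liftQ a hle ∘ₗ e.symm.toLinearMap, ?_⟩
      apply LinearMap.ext; intro y
      have : e.symm (π y) = (LinearMap.ker π).mkQ y := by
        rw [LinearEquiv.symm_apply_eq]; rfl
      simp [this]
    · rintro ⟨b, rfl⟩ x hx
      have hx' : π x = 0 := hx
      simp [hx']

lemma mainInd {t : ℕ} (M : Type u) [AddCommGroup M] [Module R M]
    (hM : ∀ (N : Type u) [AddCommGroup N] [Module R N] [Module.Finite R N], Tors A N →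
      ∀ i < t, Subsingleton (EE R N M i)) (s : ℕ) : s + 1 < t →
    ∀ (L : Type u) [AddCommGroup L] [Module R L] [Module.Finite R L],
      (∀ r ∈ A, Fac r L) → Subsingleton (EE R L M (s + 1)) →
      ∀ (m : ℕ) (π : (Fin m → R) →ₗ[R] L), Function.Surjective π →
        Eff A (s + 1) (LinearMap.range (LinearMap.lcomp R M (LinearMap.ker π).subtype)) := by
  induction s with
  | zero =>
    intro hs L _ _ _ hF hL m π hπ
    apply eff_of_sub
    intro N _ _ _ hN
    have hsur : LinearMap.range (LinearMap.lcomp R M (LinearMap.ker π).subtype) = ⊤ :=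
      LinearMap.range_eq_top.2 fun a => (ses_ker π hπ).extend hL a
    refine sub_congr_right ((LinearEquiv.ofEq _ _ hsur).trans Submodule.topEquiv).symm _ ?_
    exact homDepth1 (hM N hN 0 (by omega)) (hM N hN 1 (by omega)) _
  | succ s ih =>
    intro hs L _ _ _ hF hL m π hπ
    obtain ⟨m', π', hπ'⟩ := exists_cover R (LinearMap.ker π)
    have h1 := ih (by omega) (LinearMap.ker π) (fun r hr => (hF r hr).ker π hπ)
      ((ses_ker π hπ).conX (sub_proj _) hL) m' π' hπ'
    have h2 : Eff A (s + 1 + 1) (LinearMap.ker π →ₗ[R] M) :=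
      eff_ses (ses_B π' hπ') (eff_of_sub fun N _ _ _ hN => sub_homF (hM N hN _ hs)) h1
    refine eff_ses (ses_mkQ _) h2 (eff_tors _ ⟨1, fun r hr x => ?_⟩ s)
    rw [pow_one] at hr
    obtain ⟨a, rfl⟩ := Submodule.mkQ_surjective _ x
    rw [← map_smul]
    simp only [Submodule.mkQ_apply, Submodule.Quotient.mk_eq_zero]
    obtain ⟨σ, hσ⟩ := (hF r hr).section π hπ
    have hs : ∀ x, π (σ x) = r • x := fun x => LinearMap.congr_fun hσ x
    let c : (Fin m → R) →ₗ[R] LinearMap.ker π :=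
      LinearMap.codRestrict _ (r • LinearMap.id - σ ∘ₗ π) (fun v => by simp [hs])
    refine ⟨a ∘ₗ c, ?_⟩
    ext v
    have : c v = r • v := by
      ext1
      have hv : π v = 0 := v.2
      simp [c, hv]
    simp [this]

end eff
end S3



namespace S3

section key
variable {R : Type u} [CommRing R] [IsNoetherianRing R] {A : Ideal R}

lemma desc_range {T E X : Type*} [AddCommGroup T] [Module R T] [AddCommGroup E] [Module R E]
    [AddCommGroup X] [Module R X] (Θ : T →ₗ[R] E) (ev : T →ₗ[R] X)
    (h : LinearMap.ker Θ ≤ LinearMap.ker ev) :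
    ∃ ev' : LinearMap.range Θ →ₗ[R] X, ∀ z, ev' ⟨Θ z, z, rfl⟩ = ev z := by
  refine ⟨(LinearMap.ker Θ).liftQ ev h ∘ₗ Θ.quotKerEquivRange.symm.toLinearMap, fun z => ?_⟩
  have : Θ.quotKerEquivRange.symm ⟨Θ z, z, rfl⟩ = (LinearMap.ker Θ).mkQ z := by
    rw [LinearEquiv.symm_apply_eq]; rfl
  simp [this]

lemma exists_trace (M : Type u) [AddCommGroup M] [Module R M] [Module.Finite R M]
    (hF : ∀ r ∈ A, Fac r M)
    (hR : ∀ (N : Type u) [AddCommGroup N] [Module R N] [Module.Finite R N], Tors A N →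
      ∀ i < 2, Subsingleton (EE R N R i)) :
    ∃ tr : (M →ₗ[R] M) →ₗ[R] R, ∀ (f : M →ₗ[R] R) (x : M), tr (f.smulRight x) = f x := by
  have hkill : ∀ x : R, (∀ a ∈ A, a * x = 0) → x = 0 := by
    intro x hx
    have h0 := hR (R ⧸ A) ⟨1, fun r hr y => by
      rw [pow_one] at hr
      rw [Algebra.smul_def, Ideal.Quotient.algebraMap_eq, Ideal.Quotient.eq_zero_iff_mem.2 hr,
        zero_mul]⟩ 0 (by omega)
    rw [sub0] at h0
    have hle : A ≤ LinearMap.ker (LinearMap.toSpanSingleton R R x) := fun a ha => by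
      simpa using hx a ha
    have := LinearMap.congr_fun (h0 (Submodule.liftQ A (LinearMap.toSpanSingleton R R x) hle))
      (Submodule.Quotient.mk 1)
    rw [LinearMap.zero_apply] at this
    rw [← this]
    exact (one_smul R x).symm
  obtain ⟨T, _, _, tm, ind, Θ, hΘ, ev, hevv⟩ : ∃ (T : Type u) (_ : AddCommGroup T)
      (_ : Module R T) (tm : (M →ₗ[R] R) → M → T) (_ : ∀ P : T → Prop, P 0 →
        (∀ x y, P x → P y → P (x + y)) → (∀ f x, P (tm f x)) → ∀ z, P z)
      (Θ : T →ₗ[R] (M →ₗ[R] M)) (_ : ∀ f x y, Θ (tm f x) y = f y • x)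
      (ev : T →ₗ[R] R), ∀ f x, ev (tm f x) = f x :=
    ⟨TensorProduct R (M →ₗ[R] R) M, inferInstance, inferInstance, fun f x => f ⊗ₜ x,
      fun P h0 ha ht z => TensorProduct.induction_on z h0 ht ha,
      dualTensorHom R M M, fun _ _ _ => rfl, contractLeft R M, fun _ _ => rfl⟩
  have hev : LinearMap.ker Θ ≤ LinearMap.ker ev := by
    intro z hz
    rw [LinearMap.mem_ker] at hz ⊢
    apply hkill
    intro r hr
    obtain ⟨m, a, b, hab⟩ := hF r hr
    have hform : ∀ z, r * ev z = ∑ j : Fin m, a (Θ z (b (Pi.single j 1))) j := by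
      intro z
      refine ind (fun z => r * ev z = ∑ j : Fin m, a (Θ z (b (Pi.single j 1))) j) ?_ ?_ ?_ z
      · simp
      · intro x y hx hy
        simp only [map_add, mul_add, hx, hy, LinearMap.add_apply, Pi.add_apply,
          Finset.sum_add_distrib]
      · intro g x
        have h1 : b (a x) = r • x := LinearMap.congr_fun hab x
        have h2 : r * g x = g (b (a x)) := by rw [h1, map_smul, smul_eq_mul]
        have h3 : ev (tm g x) = g x := hevv _ _
        rw [h3, h2]
        conv_lhs => rw [pi_eq_sum_univ' (a x), map_sum, map_sum]
        refine Finset.sum_congr rfl fun j _ => ?_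
        rw [map_smul, map_smul]
        have h4 : Θ (tm g x) (b (Pi.single j 1)) = g (b (Pi.single j 1)) • x := hΘ _ _ _
        rw [h4, map_smul]
        simp only [Pi.smul_apply, smul_eq_mul]
        rw [mul_comm]
    rw [hform, hz]
    simp
  obtain ⟨ev', hev'⟩ := desc_range Θ ev hev
  have hE := hR ((M →ₗ[R] M) ⧸ LinearMap.range Θ) ⟨1, fun r hr y => by
    rw [pow_one] at hr
    obtain ⟨h, rfl⟩ := Submodule.mkQ_surjective _ y
    rw [← map_smul]
    simp only [Submodule.mkQ_apply, Submodule.Quotient.mk_eq_zero]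
    obtain ⟨m, a, b, hab⟩ := hF r hr
    refine ⟨∑ j : Fin m, tm (LinearMap.proj j ∘ₗ a ∘ₗ h) (b (Pi.single j 1)), ?_⟩
    apply LinearMap.ext; intro x
    have h1 : b (a (h x)) = r • h x := LinearMap.congr_fun hab (h x)
    rw [LinearMap.smul_apply, ← h1]
    conv_rhs => rw [pi_eq_sum_univ' (a (h x)), map_sum]
    rw [map_sum, LinearMap.sum_apply]
    refine Finset.sum_congr rfl fun j _ => ?_
    rw [map_smul]
    have : ∀ (u : M →ₗ[R] R) (v : M), Θ (tm u v) x = u x • v := fun _ _ => hΘ _ _ _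
    rw [this]
    congr 2⟩ 1 (by omega)
  obtain ⟨tr, htr⟩ := (ses_mkQ (LinearMap.range Θ)).extend hE ev'
  refine ⟨tr, fun f x => ?_⟩
  have h1 := LinearMap.congr_fun htr ⟨Θ (tm f x), _, rfl⟩
  rw [hev', hevv] at h1
  have h2 : Θ (tm f x) = f.smulRight x := by
    apply LinearMap.ext; intro y; exact hΘ _ _ _
  have h3 : tr (Θ (tm f x)) = f x := h1
  rwa [h2] at h3

lemma key_lemma {s : ℕ} (M : Type u) [AddCommGroup M] [Module R M] [Module.Finite R M]
    (hT : TR R M) (hF : ∀ r ∈ A, Fac r M)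
    (hR : ∀ (N : Type u) [AddCommGroup N] [Module R N] [Module.Finite R N], Tors A N →
      ∀ i < s + 2, Subsingleton (EE R N R i))
    (hMM : Subsingleton (EE R M M (s + 1)))
    (N : Type u) [AddCommGroup N] [Module R N] [Module.Finite R N] (hN : Tors A N)
    (l : (M →ₗ[R] R) →ₗ[R] EE R N R (s + 2)) (f : M →ₗ[R] R)
    (hf : ∀ x g, f x • l g = 0) : l f = 0 := by
  obtain ⟨hb, -, hv⟩ := hT
  obtain ⟨tr, htr⟩ := exists_trace M hF (fun N _ _ _ hN i hi => hR N hN i (by omega))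
  obtain ⟨ξ, hξ⟩ := refl_ex hb hv (s + 2) (hR N hN) l
  have hfx : ∀ x, f x • ξ = 0 := fun x => by
    apply refl_inj hb hv (s + 2) (hR N hN)
    intro g
    rw [map_smul, hξ, hf]
  obtain ⟨m, π, hπ⟩ := exists_cover R M
  let φ : M →ₗ[R] (M →ₗ[R] M) := LinearMap.smulRightₗ f
  have h0 : push N (LinearMap.lcomp R M π) (s + 2) (push N φ (s + 2) ξ) = 0 := by
    apply homF_eq_zero
    intro j
    rw [push_push, push_push]
    have : (LinearMap.applyₗ (Pi.single j (1 : R)) : ((Fin m → R) →ₗ[R] M) →ₗ[R] M) ∘ₗ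
        LinearMap.lcomp R M π ∘ₗ φ = f (π (Pi.single j 1)) • LinearMap.id := by
      ext x; rfl
    rw [LinearMap.comp_assoc] at *
    rw [this, push_smul, push_id, hfx]
  obtain ⟨η, hη⟩ := (ses_B π hπ).cov1 _ h0
  have hEff := mainInd M (fun N _ _ _ hN i hi => refl_D hb hv (s + 2) (hR N hN) i hi) s (by omega)
    M hF hMM m π hπ
  obtain ⟨N', _, _, _, k, hN', hk, hk0⟩ := hEff N hN η
  have h1 : pull k (M →ₗ[R] M) (s + 2) (push N φ (s + 2) ξ) = 0 := by
    rw [← hη, (ses_B π hπ).pull_δ, hk0, map_zero]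
  have h2 : pull k R (s + 2) (l f) = 0 := by
    have hc : tr ∘ₗ φ = f := LinearMap.ext fun x => htr f x
    rw [← hξ f, ← hc, ← push_push, pull_push, h1, map_zero]
  obtain ⟨ζ, hζ⟩ := (ses_ker k hk).con3 (l f) h2
  have := hR (LinearMap.ker k) (by
    obtain ⟨c, hc⟩ := hN'
    exact ⟨c, fun r hr x => Subtype.ext (hc r hr x)⟩) (s + 1) (by omega)
  rw [← hζ, Subsingleton.elim ζ 0, map_zero]

end key

section locsplit
variable {R : Type u} [CommRing R] [IsNoetherianRing R]

lemma clear_den (p : Ideal R) [p.IsPrime] (D : Type u) [AddCommGroup D] [Module R D]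
    [Module.Finite R D] (φ : D →ₗ[R] p.ResidueField) (d : D)
    (h : ∀ l : D →ₗ[R] R ⧸ p, l d = 0) : φ d = 0 := by
  obtain ⟨S, hS⟩ := Module.Finite.fg_top (R := R) (M := D)
  obtain ⟨c, hc⟩ := IsLocalization.exist_integer_multiples (nonZeroDivisors (R ⧸ p)) S
    (fun y => φ y)
  obtain ⟨c0, hc0⟩ := Ideal.Quotient.mk_surjective (c : R ⧸ p)
  let ι : (R ⧸ p) →ₗ[R] p.ResidueField := (Algebra.linearMap (R ⧸ p) p.ResidueField).restrictScalars R
  have hι : Function.Injective ι := IsFractionRing.injective (R ⧸ p) p.ResidueField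
  have hcs : ∀ z : p.ResidueField, (c : R ⧸ p) • z = c0 • z := fun z => by
    rw [← hc0, Algebra.smul_def, Algebra.smul_def]; rfl
  have hr : ∀ x, (c0 • φ) x ∈ LinearMap.range ι := by
    have : (⊤ : Submodule R D) ≤ (LinearMap.range ι).comap (c0 • φ) := by
      rw [← hS, Submodule.span_le]
      intro y hy
      obtain ⟨b, hb⟩ := hc y hy
      refine ⟨b, ?_⟩
      rw [LinearMap.smul_apply, ← hcs]
      exact hb
    exact fun x => this trivial
  have h1 := h ((LinearEquiv.ofInjective ι hι).symm.toLinearMap ∘ₗ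
    LinearMap.codRestrict _ (c0 • φ) hr)
  have h2 : c0 • φ d = 0 := by
    simp only [LinearMap.comp_apply, LinearEquiv.coe_coe, LinearEquiv.map_eq_zero_iff] at h1
    exact congrArg Subtype.val h1
  rw [Algebra.smul_def, mul_eq_zero] at h2
  refine h2.resolve_left fun h3 => ?_
  rw [Ideal.algebraMap_residueField_eq_zero] at h3
  have : (c : R ⧸ p) = 0 := by rw [← hc0]; exact Ideal.Quotient.eq_zero_iff_mem.2 h3
  exact nonZeroDivisors.coe_ne_zero c this

lemma locsplit (p : Ideal R) [p.IsPrime] (D : Type u) [AddCommGroup D] [Module R D]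
    [Module.Finite R D] {r : ℕ} (j : D →ₗ[R] (Fin r → R))
    (h : ∀ d, (∀ i, j d i ∈ p) → ∀ l : D →ₗ[R] R ⧸ p, l d = 0) : ∃ s ∉ p, Fac s D := by
  set S := p.primeCompl with hS
  have hfree : Module.Free (Localization S) (LocalizedModule S (Fin r → R)) :=
    Module.free_of_isLocalizedModule S (LocalizedModule.mkLinearMap S (Fin r → R))
  have hinj : Function.Injective ((LocalizedModule.map S j).lTensor
      (IsLocalRing.ResidueField (Localization.AtPrime p))) := by
    rw [injective_iff_map_eq_zero]
    intro z hz
    obtain ⟨y, rfl⟩ : ∃ y, (1 : IsLocalRing.ResidueField (Localization.AtPrime p)) ⊗ₜ y = z :=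
      TensorProduct.mk_surjective _ _ _ IsLocalRing.residue_surjective z
    obtain ⟨⟨d, s⟩, rfl⟩ := IsLocalizedModule.mk'_surjective S (LocalizedModule.mkLinearMap S D) y
    have hunit : ∀ y : IsLocalRing.ResidueField (Localization.AtPrime p), (s : R) • y = 0 →
        y = 0 := fun y hy => by
      rw [Algebra.smul_def, mul_eq_zero] at hy
      refine hy.resolve_left fun h3 => ?_
      rw [Ideal.algebraMap_residueField_eq_zero] at h3
      exact s.2 h3
    have hmk : (s : R) • IsLocalizedModule.mk' (LocalizedModule.mkLinearMap S D) d s =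
        LocalizedModule.mkLinearMap S D d :=
      IsLocalizedModule.mk'_cancel' (LocalizedModule.mkLinearMap S D) d s
    set y := IsLocalizedModule.mk' (LocalizedModule.mkLinearMap S D) d s with hy
    have hj : ∀ i, j d i ∈ p := by
      intro i
      let g0 : (Fin r → R) →ₗ[R] IsLocalRing.ResidueField (Localization.AtPrime p) :=
        Algebra.linearMap R _ ∘ₗ LinearMap.proj i
      have hg0 : ∀ x : S, IsUnit (algebraMap R
          (Module.End R (IsLocalRing.ResidueField (Localization.AtPrime p))) x) := by
        intro x
        have hx : algebraMap R (IsLocalRing.ResidueField (Localization.AtPrime p)) x ≠ 0 := by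
          intro h3
          rw [Ideal.algebraMap_residueField_eq_zero] at h3
          exact x.2 h3
        rw [Module.End.isUnit_iff]
        constructor
        · rw [injective_iff_map_eq_zero]
          intro z hz
          rw [Module.algebraMap_end_apply, Algebra.smul_def, mul_eq_zero] at hz
          exact hz.resolve_left hx
        · intro z
          refine ⟨(algebraMap R _ x)⁻¹ * z, ?_⟩
          rw [Module.algebraMap_end_apply, Algebra.smul_def, mul_inv_cancel_left₀ hx]
      let g1 := LinearMap.extendScalarsOfIsLocalization S (Localization.AtPrime p)
        (LocalizedModule.lift S g0 hg0)
      have h1 : g1 (LocalizedModule.map S j y) = 0 := by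
        have h0 : (1 : IsLocalRing.ResidueField (Localization.AtPrime p)) *
            g1 (LocalizedModule.map S j y) = _ :=
          congrArg (fun w => LinearMap.mul' (Localization.AtPrime p)
            (IsLocalRing.ResidueField (Localization.AtPrime p)) (g1.lTensor _ w)) hz
        rw [one_mul] at h0
        rw [h0]
        simp only [map_zero]
      have h2 : g1 (LocalizedModule.map S j (LocalizedModule.mkLinearMap S D d)) = 0 := by
        rw [← hmk, LinearMap.map_smul_of_tower, LinearMap.map_smul_of_tower, h1, smul_zero]
      have h4 : LocalizedModule.map S j (LocalizedModule.mkLinearMap S D d) =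
          LocalizedModule.mkLinearMap S _ (j d) :=
        IsLocalizedModule.map_apply S (LocalizedModule.mkLinearMap S D)
          (LocalizedModule.mkLinearMap S _) j d
      rw [h4] at h2
      have h5 : g1 (LocalizedModule.mkLinearMap S _ (j d)) = g0 (j d) :=
        LinearMap.congr_fun (LocalizedModule.lift_comp S g0 hg0) (j d)
      rw [h5] at h2
      exact Ideal.algebraMap_residueField_eq_zero.1 h2
    rw [← Module.forall_dual_apply_eq_zero_iff
      (IsLocalRing.ResidueField (Localization.AtPrime p))]
    intro φ
    apply hunit
    let ψ : LocalizedModule S D →ₗ[R] IsLocalRing.ResidueField (Localization.AtPrime p) :=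
      (φ.restrictScalars (Localization.AtPrime p) ∘ₗ
        TensorProduct.mk (Localization.AtPrime p) _ _ 1).restrictScalars R
    have h1 := clear_den p D (ψ ∘ₗ LocalizedModule.mkLinearMap S D) d (h d hj)
    rw [LinearMap.comp_apply, ← hmk, map_smul] at h1
    exact h1
  obtain ⟨l', hl'⟩ := (IsLocalRing.split_injective_iff_lTensor_residueField_injective
    (LocalizedModule.map S j)).2 hinj
  obtain ⟨g, s, hg⟩ := Module.FinitePresentation.exists_lift_of_isLocalizedModule S
      (LocalizedModule.mkLinearMap S D)
      (l'.restrictScalars R ∘ₗ LocalizedModule.mkLinearMap S (Fin r → R))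
  have key : LocalizedModule.mkLinearMap S D ∘ₗ (g ∘ₗ j) =
        LocalizedModule.mkLinearMap S D ∘ₗ (s • LinearMap.id) := by
    ext x
    have h1 : LocalizedModule.mkLinearMap S _ (j x) =
        LocalizedModule.map S j (LocalizedModule.mkLinearMap S _ x) :=
        (IsLocalizedModule.map_apply S (LocalizedModule.mkLinearMap S D)
          (LocalizedModule.mkLinearMap S _) j x).symm
    have h2 := LinearMap.congr_fun hg (j x)
    have h3 := LinearMap.congr_fun hl' (LocalizedModule.mkLinearMap S D x)
    simp only [LinearMap.comp_apply] at h2 ⊢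
    rw [h2]
    simp only [LinearMap.smul_apply, LinearMap.comp_apply, LinearMap.restrictScalars_apply,
        LinearMap.id_apply, Submonoid.smul_def] at h3 ⊢
    rw [h1, h3, LinearMap.map_smul]
  obtain ⟨t, ht⟩ := Module.Finite.exists_smul_of_comp_eq_of_isLocalizedModule S
      (LocalizedModule.mkLinearMap S D) _ _ key
  refine ⟨(t : R) * s, (t * s).2, r, j, (t : R) • g, ?_⟩
  rw [mul_smul, LinearMap.smul_comp]
  exact ht

end locsplit
end S3



namespace S3

section fin
variable {R : Type u} [CommRing R]

lemma fac_dual (M : Type u) [AddCommGroup M] [Module R M]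
    (hb : Function.Bijective (Module.Dual.eval R M)) {s : R} (h : Fac s (M →ₗ[R] R)) :
    Fac s M := by
  obtain ⟨m, a, b, hab⟩ := h
  obtain ⟨e, he⟩ : ∃ e : M ≃ₗ[R] ((M →ₗ[R] R) →ₗ[R] R), ∀ x f, e x f = f x :=
    ⟨LinearEquiv.ofBijective _ hb, fun x f => rfl⟩
  let c : (Fin m → R) →ₗ[R] ((M →ₗ[R] R) →ₗ[R] R) :=
    ∑ j, (LinearMap.proj j : (Fin m → R) →ₗ[R] R).smulRight (LinearMap.proj j ∘ₗ a)
  refine ⟨m, LinearMap.pi fun j => b (Pi.single j 1), e.symm.toLinearMap ∘ₗ c, ?_⟩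
  apply LinearMap.ext; intro x
  rw [LinearMap.comp_apply, LinearMap.comp_apply, LinearEquiv.coe_coe, LinearEquiv.symm_apply_eq]
  apply LinearMap.ext; intro f
  have h1 : b (a f) x = s * f x := by
    have := LinearMap.congr_fun (LinearMap.congr_fun hab f) x
    simpa using this
  rw [he, LinearMap.smul_apply, LinearMap.id_apply, map_smul, smul_eq_mul, ← h1]
  conv_rhs => rw [pi_eq_sum_univ' (a f), map_sum, LinearMap.sum_apply]
  simp only [c, LinearMap.sum_apply]
  refine Finset.sum_congr rfl fun j _ => ?_
  simp [mul_comm]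

lemma depth_vals [IsLocalRing R] {d : ℕ} (h : moduleDepth R (ModuleCat.of R R) = d) :
    (∀ i < d, Subsingleton (EE R (IsLocalRing.ResidueField R) R i)) ∧
      Nontrivial (EE R (IsLocalRing.ResidueField R) R d) := by
  constructor
  · intro i hi
    rw [← ext_bridge]
    by_contra hcon
    rw [not_subsingleton_iff_nontrivial] at hcon
    have : moduleDepth R (ModuleCat.of R R) ≤ i := sInf_le ⟨i, rfl, hcon⟩
    rw [h] at this
    have : d ≤ i := by exact_mod_cast this
    omega
  · rw [← not_subsingleton_iff_nontrivial, ← ext_bridge, not_subsingleton_iff_nontrivial]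
    have hne : {i : ℕ∞ | ∃ n : ℕ, i = n ∧ Nontrivial (ExtMod R (ModuleCat.of R
        (IsLocalRing.ResidueField R)) (ModuleCat.of R R) n)}.Nonempty := by
      rw [Set.nonempty_iff_ne_empty]
      intro he
      rw [moduleDepth, he, sInf_empty] at h
      exact ENat.top_ne_natCast d h
    obtain ⟨n, hn, hnt⟩ := csInf_mem hne
    have : (d : ℕ∞) = n := h.symm.trans hn
    have : d = n := by exact_mod_cast this
    rw [this]; exact hnt

end fin

lemma main (R : Type u) [CommRing R] [IsLocalRing R] [IsNoetherianRing R] (d n : ℕ)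
    (hd : 2 ≤ d) (hCM : IsCMLocalOfDim R d) (hn1 : 1 ≤ n) (hn2 : n ≤ d - 1)
    (M : Type u) [AddCommGroup M] [Module R M] [Module.Finite R M]
    (hloc : ∀ (p : Ideal R) (hp : p.IsPrime), primeHt R p hp ≤ (n : ℕ∞) →
      FinitePd (Localization.AtPrime p) (LocalizedModule p.primeCompl M))
    (hG : FiniteGdim R (M →ₗ[R] R))
    (h1 : ∀ i : ℕ, 1 ≤ i → i ≤ d → Subsingleton (EE R M R i))
    (h2 : ∀ j : ℕ, n ≤ j → j ≤ d - 1 → Subsingleton (EE R M M j)) :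
    Fac (1 : R) M := by
  classical
  obtain ⟨hdim, hdep⟩ := hCM
  obtain ⟨hk, hkd⟩ := depth_vals hdep
  obtain ⟨e, rfl⟩ : ∃ e, d = e + 1 := ⟨d - 1, by omega⟩
  have hT : TR R M := step1 (by omega) hk hkd M hG fun i hi => h1 (i + 1) (by omega) (by omega)
  set A := facIdeal R M with hA
  by_contra hcon
  have hAm : A ≤ IsLocalRing.maximalIdeal R := by
    apply IsLocalRing.le_maximalIdeal
    intro h
    apply hcon
    rw [← mem_facIdeal, ← hA, h]
    trivial
  have hht : ∀ p : PrimeSpectrum R, A ≤ p.asIdeal → ¬ Order.height p ≤ n := by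
    intro p hp hle
    obtain ⟨m, hm⟩ := hloc p.asIdeal p.2 hle
    obtain ⟨s, hs, hsF⟩ := step2 p.asIdeal m M hT.2.1 (pd_of_pdle m _ hm)
    exact hs (hp hsF)
  have hex : ∃ i, ∃ p : PrimeSpectrum R, A ≤ p.asIdeal ∧
      ¬ Subsingleton (EE R (R ⧸ p.asIdeal) R i) :=
    ⟨e + 1, IsLocalRing.closedPoint R, hAm, not_subsingleton_iff_nontrivial.2 hkd⟩
  have hte : Nat.find hex ≤ e + 1 := Nat.find_min' hex
    ⟨IsLocalRing.closedPoint R, hAm, not_subsingleton_iff_nontrivial.2 hkd⟩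
  obtain ⟨p, hpA, hpne⟩ := Nat.find_spec hex
  have hmin : ∀ i < Nat.find hex, ∀ q : PrimeSpectrum R, A ≤ q.asIdeal →
      Subsingleton (EE R (R ⧸ q.asIdeal) R i) := by
    intro i hi q hq
    have := Nat.find_min hex hi
    push Not at this
    exact this q hq
  generalize Nat.find hex = t at *
  have htn : n < t := by
    by_contra hle
    exact hpne (isch_ht hk hdim p (hht p hpA) t (by omega))
  obtain ⟨s, rfl⟩ : ∃ s, t = s + 2 := ⟨t - 2, by omega⟩
  have hR : ∀ (N : Type u) [AddCommGroup N] [Module R N] [Module.Finite R N], Tors A N →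
      ∀ i < s + 2, Subsingleton (EE R N R i) := fun N _ _ _ hN i hi =>
    filt_tors A i R N hN (hmin i hi)
  have hpt : ∀ (q : PrimeSpectrum R), A ≤ q.asIdeal → Tors A (R ⧸ q.asIdeal) := fun q hq =>
    ⟨1, fun r hr y => by
      rw [pow_one] at hr
      rw [Algebra.smul_def, Ideal.Quotient.algebraMap_eq, Ideal.Quotient.eq_zero_iff_mem.2 (hq hr),
        zero_mul]⟩
  rw [not_subsingleton_iff_nontrivial] at hpne
  obtain ⟨P, hP⟩ := associatedPrimes.nonempty R (EE R (R ⧸ p.asIdeal) R (s + 2))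
  obtain ⟨hPp, ι, hι⟩ := (isAssociatedPrime_iff_exists_injective_linearMap _ _).1 hP
  have hmk : ∀ r ∈ P, ∀ y : R ⧸ P, r • y = 0 := fun r hr y => by
    rw [Algebra.smul_def, Ideal.Quotient.algebraMap_eq, Ideal.Quotient.eq_zero_iff_mem.2 hr,
      zero_mul]
  have hAP : A ≤ P := by
    intro r hr
    have h0 : r • ι 1 = 0 := smul_eq_zero_of_src r (fun y => by
      rw [Algebra.smul_def, Ideal.Quotient.algebraMap_eq,
        Ideal.Quotient.eq_zero_iff_mem.2 (hpA hr), zero_mul]) (s + 2) (ι 1)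
    rw [← map_smul] at h0
    have h3 : r • (1 : R ⧸ P) = 0 := hι (by rw [h0, map_zero])
    rwa [Algebra.smul_def, Ideal.Quotient.algebraMap_eq, mul_one,
      Ideal.Quotient.eq_zero_iff_mem] at h3
  obtain ⟨m, π, hπ⟩ := exists_cover R M
  let j : (M →ₗ[R] R) →ₗ[R] (Fin m → R) :=
    LinearMap.pi fun i => LinearMap.applyₗ (π (Pi.single i 1))
  obtain ⟨s', hs', hF⟩ := locsplit P (M →ₗ[R] R) j (by
    intro f hf l
    have hfP : ∀ x, f x ∈ P := by
      intro x
      obtain ⟨v, rfl⟩ := hπ x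
      rw [pi_eq_sum_univ' v, map_sum, map_sum]
      refine Ideal.sum_mem _ fun i _ => ?_
      rw [map_smul, map_smul, smul_eq_mul]
      exact Ideal.mul_mem_left _ _ (hf i)
    have h0 := key_lemma M hT (fun r hr => hr) hR (h2 (s + 1) (by omega) (by omega))
      (R ⧸ p.asIdeal) (hpt p hpA) (ι ∘ₗ l) f (fun x g => by
        rw [LinearMap.comp_apply, ← map_smul, hmk _ (hfP x), map_zero])
    exact hι (by rw [map_zero]; exact h0))
  exact hs' (hAP (fac_dual M hT.1 hF))
end S3


theorem stmt3 (R : Type u) [CommRing R] [IsLocalRing R] [IsNoetherianRing R] (d n : ℕ)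
    (hd : 2 ≤ d) (hCM : IsCMLocalOfDim R d) (hn1 : 1 ≤ n) (hn2 : n ≤ d - 1)
    (M : Type u) [AddCommGroup M] [Module R M] [Module.Finite R M]
    (hloc : ∀ (p : Ideal R) (hp : p.IsPrime), primeHt R p hp ≤ (n : ℕ∞) →
      FinitePd (Localization.AtPrime p) (LocalizedModule p.primeCompl M))
    (hG : FiniteGdim R (M →ₗ[R] R))
    (h1 : ∀ i : ℕ, 1 ≤ i → i ≤ d →
      Subsingleton (ExtMod R (ModuleCat.of R M) (ModuleCat.of R R) i))
    (h2 : ∀ j : ℕ, n ≤ j → j ≤ d - 1 →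
      Subsingleton (ExtMod R (ModuleCat.of R M) (ModuleCat.of R M) j)) :
    Module.Free R M := by
  obtain ⟨m, a, b, hab⟩ := S3.main R d n hd hCM hn1 hn2 M hloc hG
    (fun i hi hi' => (S3.ext_bridge R M R i).1 (h1 i hi hi'))
    (fun j hj hj' => (S3.ext_bridge R M M j).1 (h2 j hj hj'))
  have : Module.Projective R M := Module.Projective.of_split a b (by rw [hab, one_smul])
  exact Module.free_of_flat_of_isLocalRing
end
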